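/- arXiv:1905.03374 — 6 statements merged into one kernel-verified Lean document; each statement's English description precedes it below -/
import Mathlib

section
/- Let g : ℕ → ℝ be a generalised polynomial. Then the map ℕ → ℝ given by n ↦ 1 if g(n) ≥ 0 and n ↦ 0 otherwise is a generalised polynomial on ℕ. -/
/-- Generalised polynomial maps `ℝ^d → ℝ`: the smallest family containing coordinate
maps and constants, closed under addition, multiplication and integer part. -/
inductive IsGenPoly {d : ℕ} : ((Fin d → ℝ) → ℝ) → Prop
  | coord (i : Fin d) : IsGenPoly (fun x => x i)
  | const (c : ℝ) : IsGenPoly (fun _ => c)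
  | add {f g : (Fin d → ℝ) → ℝ} : IsGenPoly f → IsGenPoly g →
      IsGenPoly (fun x => f x + g x)
  | mul {f g : (Fin d → ℝ) → ℝ} : IsGenPoly f → IsGenPoly g →
      IsGenPoly (fun x => f x * g x)
  | intPart {f : (Fin d → ℝ) → ℝ} : IsGenPoly f →
      IsGenPoly (fun x => (⌊f x⌋ : ℝ))

/-- A generalised polynomial on `ℕ`: the restriction to `ℕ` of a generalised
polynomial `ℝ → ℝ`. -/
def IsGenPolyNat (g : ℕ → ℝ) : Prop :=
  ∃ f : (Fin 1 → ℝ) → ℝ, IsGenPoly f ∧ ∀ n : ℕ, g n = f (fun _ => (n : ℝ))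

/-- A generalised polynomial subset of `ℕ`: the zero set of a generalised polynomial. -/
def IsGenPolySet (E : Set ℕ) : Prop :=
  ∃ g : ℕ → ℝ, IsGenPolyNat g ∧ E = {n : ℕ | g n = 0}

namespace IsGenPolyNat

lemma const (c : ℝ) : IsGenPolyNat (fun _ => c) :=
  ⟨_, .const c, fun _ => rfl⟩

lemma natCast : IsGenPolyNat (fun n => (n : ℝ)) :=
  ⟨_, .coord 0, fun _ => rfl⟩

lemma add {f g : ℕ → ℝ} (hf : IsGenPolyNat f) (hg : IsGenPolyNat g) :
    IsGenPolyNat (fun n => f n + g n) := by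
  obtain ⟨F, hF, hfF⟩ := hf
  obtain ⟨G, hG, hgG⟩ := hg
  exact ⟨_, hF.add hG, fun n => by simp only [hfF, hgG]⟩

lemma mul {f g : ℕ → ℝ} (hf : IsGenPolyNat f) (hg : IsGenPolyNat g) :
    IsGenPolyNat (fun n => f n * g n) := by
  obtain ⟨F, hF, hfF⟩ := hf
  obtain ⟨G, hG, hgG⟩ := hg
  exact ⟨_, hF.mul hG, fun n => by simp only [hfF, hgG]⟩

lemma floor {f : ℕ → ℝ} (hf : IsGenPolyNat f) : IsGenPolyNat (fun n => (⌊f n⌋ : ℝ)) := by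
  obtain ⟨F, hF, hfF⟩ := hf
  exact ⟨_, hF.intPart, fun n => by simp only [hfF]⟩

lemma const_sub {f : ℕ → ℝ} (c : ℝ) (hf : IsGenPolyNat f) : IsGenPolyNat (fun n => c - f n) := by
  convert (const c).add ((const (-1)).mul hf) using 2
  ring

lemma fract {f : ℕ → ℝ} (hf : IsGenPolyNat f) : IsGenPolyNat (fun n => Int.fract (f n)) := by
  convert hf.add (hf.floor.const_sub 0) using 2
  rw [Int.fract]
  ring

end IsGenPolyNat

/-- A sequence takes only countably many values, so some dilation moves all its nonzero values
off the integers. -/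
lemma exists_mul_eq_intCast_imp_eq_zero (g : ℕ → ℝ) :
    ∃ θ : ℝ, ∀ (n : ℕ) (k : ℤ), θ * g n = k → g n = 0 := by
  have hc : (Set.range fun p : ℕ × ℤ => (p.2 : ℝ) / g p.1).Countable := Set.countable_range _
  obtain ⟨θ, hθ⟩ : ∃ θ : ℝ, θ ∉ Set.range fun p : ℕ × ℤ => (p.2 : ℝ) / g p.1 := by
    by_contra! h
    exact Set.not_countable_univ (hc.mono fun x _ => h x)
  refine ⟨θ, fun n k hk => ?_⟩
  by_contra h0
  exact hθ ⟨(n, k), by simp only [← hk]; field_simp⟩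

lemma IsGenPolyNat.indicator_eq_zero {g : ℕ → ℝ} (hg : IsGenPolyNat g) :
    IsGenPolyNat (fun n => if g n = 0 then (1 : ℝ) else 0) := by
  obtain ⟨θ, hθ⟩ := exists_mul_eq_intCast_imp_eq_zero g
  convert (((const θ).mul hg).fract.const_sub 1).floor using 2 with n
  split_ifs with h
  · simp [h]
  · have hpos : 0 < Int.fract (θ * g n) := by
      rw [Int.fract_pos]
      exact fun h' => h (hθ n _ h')
    have hlt := Int.fract_lt_one (θ * g n)
    have : ⌊1 - Int.fract (θ * g n)⌋ = 0 := by
      rw [Int.floor_eq_zero_iff]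
      constructor <;> linarith
    simp [this]

lemma IsGenPolyNat.indicator_nonneg_of_bounded {g : ℕ → ℝ} (hg : IsGenPolyNat g) {C : ℝ}
    (hC : ∀ n, |g n| < C) : IsGenPolyNat (fun n => if 0 ≤ g n then (1 : ℝ) else 0) := by
  have hC0 : 0 < C := (abs_nonneg _).trans_lt (hC 0)
  convert ((const C⁻¹).mul hg).floor.add (const 1) using 2 with n
  obtain ⟨h1, h2⟩ := abs_lt.mp (hC n)
  have hup : C⁻¹ * g n < 1 := by rw [inv_mul_lt_iff₀ hC0]; linarith
  have hlo : -1 ≤ C⁻¹ * g n := by rw [le_inv_mul_iff₀ hC0]; linarith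
  split_ifs with h
  · have : ⌊C⁻¹ * g n⌋ = 0 := by
      rw [Int.floor_eq_zero_iff]
      exact ⟨by positivity, hup⟩
    simp [this]
  · have : ⌊C⁻¹ * g n⌋ = -1 := by
      rw [Int.floor_eq_iff]
      push_cast
      exact ⟨hlo, by rw [inv_mul_lt_iff₀ hC0]; linarith⟩
    simp [this]

/-- Polynomials in `n` whose coefficients are bounded generalised polynomials, in Horner form. -/
inductive HasBoundedCoeffs : (ℕ → ℝ) → Prop
  | bounded {h : ℕ → ℝ} (C : ℝ) : IsGenPolyNat h → (∀ n, |h n| < C) → HasBoundedCoeffs h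
  | horner {f h : ℕ → ℝ} (C : ℝ) : HasBoundedCoeffs f → IsGenPolyNat h → (∀ n, |h n| < C) →
      HasBoundedCoeffs (fun n => n * f n + h n)

namespace HasBoundedCoeffs

lemma const (c : ℝ) : HasBoundedCoeffs (fun _ => c) :=
  .bounded (|c| + 1) (.const c) fun _ => lt_add_one _

lemma isGenPolyNat {f : ℕ → ℝ} (hf : HasBoundedCoeffs f) : IsGenPolyNat f := by
  induction hf with
  | bounded C hh _ => exact hh
  | horner C _ hh _ ih => exact (IsGenPolyNat.natCast.mul ih).add hh

lemma natCast_mul {f : ℕ → ℝ} (hf : HasBoundedCoeffs f) :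
    HasBoundedCoeffs (fun n => n * f n) := by
  simpa using hf.horner (h := fun _ => 0) 1 (.const 0) (by simp)

lemma abs_add_lt {a b C D : ℝ} (ha : |a| < C) (hb : |b| < D) : |a + b| < C + D :=
  (abs_add_le a b).trans_lt (add_lt_add ha hb)

lemma add_bounded {f h : ℕ → ℝ} {C : ℝ} (hf : HasBoundedCoeffs f) (hh : IsGenPolyNat h)
    (hC : ∀ n, |h n| < C) : HasBoundedCoeffs (fun n => f n + h n) := by
  cases hf with
  | bounded D hf hD => exact .bounded (D + C) (hf.add hh) fun n => abs_add_lt (hD n) (hC n)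
  | horner D hf hk hD =>
    simp only [add_assoc]
    exact .horner (D + C) hf (hk.add hh) fun n => abs_add_lt (hD n) (hC n)

lemma add {f g : ℕ → ℝ} (hf : HasBoundedCoeffs f) (hg : HasBoundedCoeffs g) :
    HasBoundedCoeffs (fun n => f n + g n) := by
  induction hf generalizing g with
  | bounded C hh hC => simpa only [add_comm] using hg.add_bounded hh hC
  | @horner f h C hf hh hC ih =>
    cases hg with
    | bounded D hk hD => exact (hf.horner C hh hC).add_bounded hk hD
    | @horner g k D hg hk hD =>
      convert ((ih hg).natCast_mul.add_bounded hh hC).add_bounded hk hD using 2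
      ring

lemma bounded_mul {f h : ℕ → ℝ} {C : ℝ} (hh : IsGenPolyNat h) (hC : ∀ n, |h n| < C)
    (hf : HasBoundedCoeffs f) : HasBoundedCoeffs (fun n => h n * f n) := by
  have habs {k : ℕ → ℝ} {D : ℝ} (hD : ∀ n, |k n| < D) (n : ℕ) : |h n * k n| < C * D := by
    rw [abs_mul]
    exact mul_lt_mul'' (hC n) (hD n) (abs_nonneg _) (abs_nonneg _)
  induction hf with
  | bounded D hk hD => exact .bounded (C * D) (hh.mul hk) (habs hD)
  | horner D _ hk hD ih =>
    convert ih.horner (C * D) (hh.mul hk) (habs hD) using 2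
    ring

lemma mul {f g : ℕ → ℝ} (hf : HasBoundedCoeffs f) (hg : HasBoundedCoeffs g) :
    HasBoundedCoeffs (fun n => f n * g n) := by
  induction hf with
  | bounded C hh hC => exact bounded_mul hh hC hg
  | horner C _ hh hC ih =>
    convert ih.natCast_mul.add (bounded_mul hh hC hg) using 2
    ring

lemma floor {f : ℕ → ℝ} (hf : HasBoundedCoeffs f) :
    HasBoundedCoeffs (fun n => (⌊f n⌋ : ℝ)) := by
  convert hf.add_bounded (C := 1) (hf.isGenPolyNat.fract.const_sub 0) (fun n => ?_) using 2 with n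
  · rw [Int.fract]
    ring
  · rw [zero_sub, abs_neg, Int.abs_fract]
    exact Int.fract_lt_one _

/-- Where `n * f n` is comparable to `h n` the sum `n * f n + h n` is bounded; elsewhere its sign
is that of `f n`. -/
lemma indicator_nonneg {g : ℕ → ℝ} (hg : HasBoundedCoeffs g) :
    IsGenPolyNat (fun n => if 0 ≤ g n then (1 : ℝ) else 0) := by
  induction hg with
  | bounded C hh hC => exact hh.indicator_nonneg_of_bounded hC
  | @horner f h C hf hh hC ih =>
    have hC0 : 0 < C := (abs_nonneg _).trans_lt (hC 0)
    have hg := (hf.horner C hh hC).isGenPolyNat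
    have hu : IsGenPolyNat fun n => (⌊C⁻¹ * (n * f n)⌋ : ℝ) :=
      ((IsGenPolyNat.const C⁻¹).mul hf.natCast_mul.isGenPolyNat).floor
    have hA := (hu.mul (hu.add (.const 1))).indicator_eq_zero
    have hB := (hg.mul hA).indicator_nonneg_of_bounded (C := 2 * C) fun n => by
      split_ifs with h0
      · have hle : |(n : ℝ) * f n| ≤ C := by
          have h1 := Int.floor_le (C⁻¹ * (n * f n))
          have h2 := Int.lt_floor_add_one (C⁻¹ * (n * f n))
          rw [le_inv_mul_iff₀ hC0] at h1
          rw [inv_mul_lt_iff₀ hC0] at h2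
          rw [abs_le]
          rcases mul_eq_zero.mp h0 with h | h
          · rw [h] at h1 h2
            constructor <;> linarith
          · rw [eq_neg_of_add_eq_zero_left h] at h1 h2
            constructor <;> linarith
        have := abs_add_le ((n : ℝ) * f n) (h n)
        have := hC n
        rw [mul_one]
        linarith
      · simpa using hC0
    convert (hA.mul hB).add ((hA.const_sub 1).mul ih) using 2 with n
    by_cases h0 : (⌊C⁻¹ * (n * f n)⌋ : ℝ) * (⌊C⁻¹ * (n * f n)⌋ + 1) = 0
    · simp [h0]
    · have hsign : 0 ≤ n * f n + h n ↔ 0 ≤ f n := by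
        obtain ⟨h1, h2⟩ := abs_lt.mp (hC n)
        have hn : (0 : ℝ) ≤ n := n.cast_nonneg
        constructor
        · intro hs
          by_contra! hf0
          have hnonpos : n * f n ≤ 0 := mul_nonpos_of_nonneg_of_nonpos hn hf0.le
          have hneg : ⌊C⁻¹ * (n * f n)⌋ < 0 ∨ ⌊C⁻¹ * (n * f n)⌋ = 0 := by
            rw [← le_iff_lt_or_eq, ← Int.lt_add_one_iff, Int.floor_lt]
            push_cast
            rw [inv_mul_lt_iff₀ hC0]
            linarith
          have hge : -1 ≤ ⌊C⁻¹ * (n * f n)⌋ := by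
            rw [Int.le_floor]
            push_cast
            rw [le_inv_mul_iff₀ hC0]
            linarith
          apply h0
          rcases hneg with hneg | hzero
          · have : ⌊C⁻¹ * (n * f n)⌋ = -1 := by omega
            simp [this]
          · simp [hzero]
        · intro hf0
          by_contra! hs
          have : ⌊C⁻¹ * (n * f n)⌋ = 0 := by
            rw [Int.floor_eq_zero_iff]
            exact ⟨by positivity, by rw [inv_mul_lt_iff₀ hC0]; linarith⟩
          exact h0 (by simp [this])
      simp [h0, hsign]

end HasBoundedCoeffs

lemma IsGenPoly.hasBoundedCoeffs {d : ℕ} {f : (Fin d → ℝ) → ℝ} (hf : IsGenPoly f) :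
    HasBoundedCoeffs (fun n => f fun _ => (n : ℝ)) := by
  induction hf with
  | coord i => simpa using (HasBoundedCoeffs.const 1).natCast_mul
  | const c => exact .const c
  | add _ _ ihf ihg => exact ihf.add ihg
  | mul _ _ ihf ihg => exact ihf.mul ihg
  | intPart _ ih => exact ih.floor

/-- If `g : ℕ → ℝ` is a generalised polynomial, then so is the
indicator `n ↦ [g(n) ≥ 0]`. -/
theorem indicator_nonneg_genPoly (g : ℕ → ℝ) (hg : IsGenPolyNat g) :
    IsGenPolyNat (fun n => if 0 ≤ g n then (1 : ℝ) else 0) := by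
  obtain ⟨f, hf, hgf⟩ := hg
  simp only [hgf]
  exact hf.hasBoundedCoeffs.indicator_nonneg
end

section
/- Let X ⊆ ℝ^d be a countably infinite set such that its Zariski closure V is irreducible. Then there exists an infinite subset Y ⊆ X such that for every infinite subset Z ⊆ Y, the Zariski closure of Z equals V. -/
/-- An algebraic variety in `ℝ^ι`: the common zero set of a family of polynomials. -/
def IsAlgVariety {ι : Type} (V : Set (ι → ℝ)) : Prop :=
  ∃ F : Set (MvPolynomial ι ℝ), V = {x | ∀ f ∈ F, MvPolynomial.eval x f = 0}

/-- The Zariski closure of a set `X ⊆ ℝ^ι`: the smallest algebraic variety containing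
it, i.e. the zero locus of the ideal of `X`. -/
def zariskiClosure {ι : Type} (X : Set (ι → ℝ)) : Set (ι → ℝ) :=
  {x | ∀ f : MvPolynomial ι ℝ,
    (∀ y ∈ X, MvPolynomial.eval y f = 0) → MvPolynomial.eval x f = 0}

/-- A variety is irreducible if it is not the union of two algebraic varieties
other than itself. -/
def IsIrreducibleVariety {ι : Type} (V : Set (ι → ℝ)) : Prop :=
  ∀ V₁ V₂ : Set (ι → ℝ), IsAlgVariety V₁ → IsAlgVariety V₂ → V = V₁ ∪ V₂ →
    V = V₁ ∨ V = V₂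

theorem IsAlgVariety.union {ι : Type} {A B : Set (ι → ℝ)} (hA : IsAlgVariety A)
    (hB : IsAlgVariety B) : IsAlgVariety (A ∪ B) := by
  obtain ⟨F, rfl⟩ := hA
  obtain ⟨G, rfl⟩ := hB
  refine ⟨{h | ∃ f ∈ F, ∃ g ∈ G, h = f * g}, ?_⟩
  ext x
  constructor
  · rintro (hx | hx) _ ⟨f, hf, g, hg, rfl⟩
    · simp [hx f hf]
    · simp [hx g hg]
  · intro hx
    by_contra hcon
    simp only [Set.mem_union, Set.mem_ofPred_eq, not_or, not_forall] at hcon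
    obtain ⟨⟨f, hf, hfx⟩, g, hg, hgx⟩ := hcon
    have := hx _ ⟨f, hf, g, hg, rfl⟩
    rw [map_mul] at this
    exact (mul_ne_zero hfx hgx) this

theorem IsAlgVariety.inter {ι : Type} {A B : Set (ι → ℝ)} (hA : IsAlgVariety A)
    (hB : IsAlgVariety B) : IsAlgVariety (A ∩ B) := by
  obtain ⟨F, rfl⟩ := hA
  obtain ⟨G, rfl⟩ := hB
  refine ⟨F ∪ G, ?_⟩
  ext x
  exact ⟨fun hx f hf => hf.elim (hx.1 f) (hx.2 f),
    fun hx => ⟨fun f hf => hx f (Or.inl hf), fun f hf => hx f (Or.inr hf)⟩⟩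

theorem isAlgVariety_empty {ι : Type} : IsAlgVariety (∅ : Set (ι → ℝ)) :=
  ⟨{1}, by ext x; simp⟩

theorem isAlgVariety_singleton {ι : Type} (a : ι → ℝ) : IsAlgVariety {a} :=
  ⟨Set.range fun i => MvPolynomial.X i - MvPolynomial.C (a i), by
    ext x; simp [sub_eq_zero, funext_iff]⟩

theorem isAlgVariety_zariskiClosure {ι : Type} (X : Set (ι → ℝ)) :
    IsAlgVariety (zariskiClosure X) :=
  ⟨{f | ∀ y ∈ X, MvPolynomial.eval y f = 0}, rfl⟩

theorem subset_zariskiClosure {ι : Type} (X : Set (ι → ℝ)) : X ⊆ zariskiClosure X :=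
  fun x hx _ hf => hf x hx

theorem IsAlgVariety.zariskiClosure_subset {ι : Type} {X A : Set (ι → ℝ)}
    (hA : IsAlgVariety A) (h : X ⊆ A) : zariskiClosure X ⊆ A := by
  obtain ⟨F, rfl⟩ := hA
  exact fun x hx f hf => hx f fun y hy => h hy f hf

theorem IsIrreducibleVariety.subset_or_subset {ι : Type} {X A B : Set (ι → ℝ)}
    (hirr : IsIrreducibleVariety (zariskiClosure X)) (hA : IsAlgVariety A)
    (hB : IsAlgVariety B) (h : X ⊆ A ∪ B) : X ⊆ A ∨ X ⊆ B := by
  have hV := isAlgVariety_zariskiClosure X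
  have hcover : zariskiClosure X = (zariskiClosure X ∩ A) ∪ (zariskiClosure X ∩ B) := by
    rw [← Set.inter_union_distrib_left, eq_comm, Set.inter_eq_left]
    exact (hA.union hB).zariskiClosure_subset h
  refine (hirr _ _ (hV.inter hA) (hV.inter hB) hcover).imp (fun h => ?_) (fun h => ?_)
  · exact (subset_zariskiClosure X).trans (Set.inter_eq_left.mp h.symm)
  · exact (subset_zariskiClosure X).trans (Set.inter_eq_left.mp h.symm)

/-- A set with irreducible closure is not covered by finitely many varieties not containing it. -/
theorem IsIrreducibleVariety.not_subset_biUnion_lt {ι : Type} {X : Set (ι → ℝ)}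
    (hX : X.Nonempty) (hirr : IsIrreducibleVariety (zariskiClosure X))
    {g : ℕ → Set (ι → ℝ)} (hg : ∀ k, IsAlgVariety (g k)) (hXg : ∀ k, ¬ X ⊆ g k) (n : ℕ) :
    IsAlgVariety (⋃ k < n, g k) ∧ ¬ X ⊆ ⋃ k < n, g k := by
  induction n with
  | zero => simpa [isAlgVariety_empty, Set.subset_empty_iff] using hX.ne_empty
  | succ n ih =>
    rw [Set.biUnion_lt_succ]
    exact ⟨ih.1.union (hg n),
      fun h => (hirr.subset_or_subset ih.1 (hg n) h).elim ih.2 (hXg n)⟩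

/-- The common zeros of the polynomials of total degree at most `D` vanishing on `F`. -/
def boundedDegreeClosure {ι : Type} (D : ℕ) (F : Set (ι → ℝ)) : Set (ι → ℝ) :=
  {x | ∀ f ∈ {f : MvPolynomial ι ℝ | f.totalDegree ≤ D ∧ ∀ y ∈ F, MvPolynomial.eval y f = 0},
    MvPolynomial.eval x f = 0}

theorem isAlgVariety_boundedDegreeClosure {ι : Type} (D : ℕ) (F : Set (ι → ℝ)) :
    IsAlgVariety (boundedDegreeClosure D F) :=
  ⟨_, rfl⟩

/-- For polynomials of bounded degree, vanishing on a set amounts to vanishing on a suitable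
finite subset. -/
theorem exists_finset_subset_boundedDegreeClosure {ι : Type} [Finite ι] (D : ℕ)
    (Z : Set (ι → ℝ)) :
    ∃ F : Finset (ι → ℝ), ↑F ⊆ Z ∧ Z ⊆ boundedDegreeClosure D (F : Set (ι → ℝ)) := by
  let M := MvPolynomial.restrictTotalDegree ι ℝ D
  let N : Z → Submodule ℝ M := fun z =>
    LinearMap.ker ((MvPolynomial.aeval (R := ℝ) z.1).toLinearMap ∘ₗ M.subtype)
  obtain ⟨F, hF⟩ := Finset.exists_inf_le N
  refine ⟨F.map (Function.Embedding.subtype _), by simp, fun z hz f ⟨hfD, hf⟩ => ?_⟩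
  have hfM : f ∈ M := (MvPolynomial.mem_restrictTotalDegree ι D f).mpr hfD
  have hmem : (⟨f, hfM⟩ : M) ∈ F.inf N := by
    rw [Submodule.mem_finsetInf]
    intro y hy
    have := hf y.1 (by simpa using hy)
    simpa [N, MvPolynomial.aeval_eq_eval] using this
  have := hF ⟨z, hz⟩ hmem
  simpa [N, MvPolynomial.aeval_eq_eval] using this

/-- The Zariski closure of `Z` is cut out by the polynomials of some bounded degree vanishing on
a finite subset of `Z`. -/
theorem exists_boundedDegreeClosure_between {ι : Type} [Finite ι] (Z : Set (ι → ℝ)) :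
    ∃ (D : ℕ) (F : Finset (ι → ℝ)), ↑F ⊆ Z ∧ Z ⊆ boundedDegreeClosure D (F : Set (ι → ℝ)) ∧
      boundedDegreeClosure D (F : Set (ι → ℝ)) ⊆ zariskiClosure Z := by
  let I : Ideal (MvPolynomial ι ℝ) := ⨅ z ∈ Z, RingHom.ker (MvPolynomial.eval z)
  have hI : ∀ f, f ∈ I ↔ ∀ z ∈ Z, MvPolynomial.eval z f = 0 := by
    simp [I, Submodule.mem_iInf, RingHom.mem_ker]
  obtain ⟨G, hG⟩ := IsNoetherian.noetherian I
  obtain ⟨F, hFZ, hZ⟩ := exists_finset_subset_boundedDegreeClosure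
    (G.sup MvPolynomial.totalDegree) Z
  refine ⟨_, F, hFZ, hZ, fun x hx f hf => ?_⟩
  have hle : I ≤ RingHom.ker (MvPolynomial.eval x) := by
    rw [← hG]
    refine Submodule.span_le.mpr fun g hg => ?_
    have hgI : g ∈ I := hG ▸ Submodule.subset_span hg
    exact hx g ⟨Finset.le_sup hg, fun y hy => (hI g).mp hgI y (hFZ hy)⟩
  exact hle ((hI f).mpr hf)

/-- Along a sequence avoiding more and more members of a family of sets that includes all
singletons of points of the sequence, the range is infinite and meets each member finitely. -/
theorem infinite_range_and_finite_inter {α : Type*} {g : ℕ → Set α} {y : ℕ → α}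
    (hy : ∀ n, ∀ k < n, y n ∉ g k) (hsing : ∀ n, ∃ k, g k = {y n}) :
    (Set.range y).Infinite ∧ ∀ k, (Set.range y ∩ g k).Finite := by
  have hfin : ∀ k, (y ⁻¹' g k).Finite := fun k =>
    (Set.finite_Iic k).subset fun n hn => not_lt.mp fun hkn => hy n k hkn hn
  refine ⟨fun hr => ?_, fun k => ?_⟩
  · have := hr.preimage' (f := y) (by
      rintro _ ⟨n, rfl⟩
      obtain ⟨k, hk⟩ := hsing n
      exact hk ▸ hfin k)
    rw [Set.preimage_range] at this
    exact Set.infinite_univ this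
  · rw [← Set.image_preimage_eq_range_inter]
    exact (hfin k).image y

/-- If `X ⊆ ℝ^d` is countably infinite with irreducible Zariski
closure `V`, then there is an infinite `Y ⊆ X` such that every infinite `Z ⊆ Y`
has Zariski closure equal to `V`. -/
theorem exists_generic_infinite_subset (d : ℕ) (X : Set (Fin d → ℝ))
    (hXc : X.Countable) (hXi : X.Infinite)
    (hirr : IsIrreducibleVariety (zariskiClosure X)) :
    ∃ Y ⊆ X, Y.Infinite ∧
      ∀ Z ⊆ Y, Z.Infinite → zariskiClosure Z = zariskiClosure X := by
  let 𝒲 : Set (Set (Fin d → ℝ)) :=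
    (fun x => {x}) '' X ∪
      {W | W ∈ (fun p : ℕ × Finset (Fin d → ℝ) => boundedDegreeClosure p.1 (p.2 : Set _)) ''
        (Set.univ ×ˢ {F : Finset (Fin d → ℝ) | (F : Set (Fin d → ℝ)) ⊆ X}) ∧ ¬ X ⊆ W}
  have hcount : 𝒲.Countable := by
    refine (hXc.image _).union (Set.Countable.mono (fun W hW => hW.1) ?_)
    have hF : {F : Finset (Fin d → ℝ) | (F : Set (Fin d → ℝ)) ⊆ X}.Countable := by
      refine ((Set.countable_ofPred_finite_subset hXc).preimage
        (Finset.coe_injective (α := Fin d → ℝ))).mono fun F hF => ?_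
      exact ⟨F.finite_toSet, hF⟩
    exact (Set.countable_univ.prod hF).image _
  have hvar : ∀ W ∈ 𝒲, IsAlgVariety W ∧ ¬ X ⊆ W := by
    rintro W (⟨x, -, rfl⟩ | ⟨⟨p, -, rfl⟩, hW⟩)
    · exact ⟨isAlgVariety_singleton x, fun h => hXi ((Set.finite_singleton x).subset h)⟩
    · exact ⟨isAlgVariety_boundedDegreeClosure _ _, hW⟩
  obtain ⟨g, hg⟩ := hcount.exists_eq_range ((hXi.nonempty.image _).mono Set.subset_union_left)
  have hmem : ∀ k, g k ∈ 𝒲 := fun k => hg ▸ Set.mem_range_self k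
  have hex : ∀ n, ∃ y ∈ X, ∀ k < n, y ∉ g k := fun n => by
    simpa [Set.not_subset] using (hirr.not_subset_biUnion_lt hXi.nonempty
      (fun k => (hvar _ (hmem k)).1) (fun k => (hvar _ (hmem k)).2) n).2
  choose y hyX hy using hex
  obtain ⟨hinf, hfin⟩ := infinite_range_and_finite_inter hy fun n => by
    have : ({y n} : Set (Fin d → ℝ)) ∈ 𝒲 := Or.inl ⟨y n, hyX n, rfl⟩
    rwa [hg] at this
  have hYX : Set.range y ⊆ X := Set.range_subset_iff.mpr hyX
  refine ⟨Set.range y, hYX, hinf, fun Z hZY hZ => ?_⟩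
  have hZX := hZY.trans hYX
  refine Set.Subset.antisymm ((isAlgVariety_zariskiClosure X).zariskiClosure_subset
    (hZX.trans (subset_zariskiClosure X))) ?_
  obtain ⟨D, F, hFZ, hZW, hWZ⟩ := exists_boundedDegreeClosure_between Z
  refine (isAlgVariety_zariskiClosure Z).zariskiClosure_subset (Set.Subset.trans ?_ hWZ)
  by_contra hXW
  have hW : boundedDegreeClosure D (F : Set (Fin d → ℝ)) ∈ 𝒲 :=
    Or.inr ⟨⟨(D, F), ⟨Set.mem_univ _, hFZ.trans hZX⟩, rfl⟩, hXW⟩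
  rw [hg] at hW
  obtain ⟨k, hk⟩ := hW
  exact hZ ((hfin k).subset (Set.subset_inter hZY (hk ▸ hZW)))
end

section
/- Let (x_n, t_n) ∈ ℝ² (n ∈ ℕ) be a sequence of points such that: (1) for each n, x_n is an accumulation point of the sequence (x_m)_{m∈ℕ} (every neighbourhood of x_n contains x_m for infinitely many m), and (2) t_n → ∞ as n → ∞. Put V := Zariski closure of {(x_n, t_n) : n ∈ ℕ} in ℝ² and X := {x_n : n ∈ ℕ}. Then either V = ℝ², or X is finite and V = X × ℝ. -/
open Filter Topology Polynomial in
/-- If a bivariate polynomial vanishes along points `(x m, t m)` with `x m → a` and `t m → ∞`,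
then its leading coefficient in the second variable vanishes at `a`. -/
theorem eval_leadingCoeff_eq_zero_of_tendsto {ι : Type*} {l : Filter ι} [l.NeBot]
    {x t : ι → ℝ} {a : ℝ} (p : ℝ[X][X]) (hx : Tendsto x l (𝓝 a)) (ht : Tendsto t l atTop)
    (hp : ∀ m, p.evalEval (x m) (t m) = 0) : p.leadingCoeff.eval a = 0 := by
  have hcoeff (i : ℕ) : Tendsto (fun m => (p.coeff i).eval (x m)) l (𝓝 ((p.coeff i).eval a)) :=
    ((p.coeff i).continuous.tendsto a).comp hx
  have hlow : Tendsto (fun m => ∑ i ∈ Finset.range p.natDegree,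
      (p.coeff i).eval (x m) * (t m ^ i / t m ^ p.natDegree)) l (𝓝 0) := by
    rw [← Finset.sum_const_zero (s := Finset.range p.natDegree)]
    refine tendsto_finsetSum _ fun i hi => ?_
    simpa using (hcoeff i).mul
      ((tendsto_pow_div_pow_atTop_zero (𝕜 := ℝ) (Finset.mem_range.1 hi)).comp ht)
  have hsum := hlow.add (hcoeff p.natDegree)
  rw [zero_add] at hsum
  refine tendsto_nhds_unique hsum (tendsto_const_nhds.congr' ?_)
  filter_upwards [ht.eventually_gt_atTop 0] with m hm
  have h := hp m
  rw [evalEval, eval_eq_sum_range (p := p), eval_finsetSum, Finset.sum_range_succ] at h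
  simp only [eval_mul, eval_pow, eval_C] at h
  have hpos : t m ^ p.natDegree ≠ 0 := by positivity
  rw [← mul_left_inj' hpos, add_mul, Finset.sum_mul, zero_mul, ← h]
  congr 1
  refine Finset.sum_congr rfl fun i _ => ?_
  field_simp

open Polynomial in
/-- Rewriting a polynomial in two variables as a polynomial in the second variable with
coefficients in the first one preserves evaluation. -/
theorem evalEval_aeval_fin_two (f : MvPolynomial (Fin 2) ℝ) (v : Fin 2 → ℝ) :
    (MvPolynomial.aeval ![(C X : ℝ[X][X]), X] f).evalEval (v 0) (v 1) =
      MvPolynomial.eval v f := by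
  induction f using MvPolynomial.induction_on with
  | C a => simp [Polynomial.algebraMap_apply, evalEval]
  | add p q hp hq => simp [evalEval_add, hp, hq]
  | mul_X p i hp => fin_cases i <;> simp [hp, evalEval]

/-- If some polynomial vanishing at all `(x n, t n)` is nonzero, only finitely many values
`x n` occur. -/
theorem finite_range_of_eval_ne_zero {x t : ℕ → ℝ}
    (h1 : ∀ n : ℕ, ∀ ε : ℝ, 0 < ε → {m : ℕ | |x m - x n| < ε}.Infinite)
    (h2 : Filter.Tendsto t Filter.atTop Filter.atTop) {f : MvPolynomial (Fin 2) ℝ}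
    (hf : ∀ n, MvPolynomial.eval ![x n, t n] f = 0) {v : Fin 2 → ℝ}
    (hv : MvPolynomial.eval v f ≠ 0) : (Set.range x).Finite := by
  have heval := evalEval_aeval_fin_two f
  set p := MvPolynomial.aeval ![(Polynomial.C Polynomial.X : Polynomial (Polynomial ℝ)),
    Polynomial.X] f
  have hp : p ≠ 0 := by
    intro h
    apply hv
    rw [← heval, h, Polynomial.evalEval_zero]
  refine (Polynomial.finite_setOfPred_isRoot (Polynomial.leadingCoeff_ne_zero.2 hp)).subset ?_
  rintro _ ⟨n, rfl⟩
  have : (Filter.atTop ⊓ Filter.comap x (nhds (x n))).NeBot := by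
    refine Filter.inf_neBot_iff_frequently_right.2 fun {q} hq => ?_
    obtain ⟨ε, hε, hball⟩ := ((Metric.nhds_basis_ball (x := x n)).comap x).eventually_iff.1 hq
    exact (Nat.frequently_atTop_iff_infinite.2 (h1 n ε hε)).mono fun m hm =>
      hball (by simpa [Real.dist_eq] using hm)
  exact eval_leadingCoeff_eq_zero_of_tendsto (x := x) (t := t) p
    (Filter.tendsto_comap.mono_left inf_le_right) (h2.mono_left inf_le_left)
    fun m => (heval ![x m, t m]).trans (hf m)

/-- If `x` has finite range, each of its values is attained infinitely often as soon as it is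
an accumulation point of the sequence. -/
theorem infinite_setOf_eq_of_finite_range {x : ℕ → ℝ} (hfin : (Set.range x).Finite) {n : ℕ}
    (h1 : ∀ ε : ℝ, 0 < ε → {m : ℕ | |x m - x n| < ε}.Infinite) :
    {m | x m = x n}.Infinite := by
  have hnhds : (Set.range x \ {x n})ᶜ ∈ nhds (x n) :=
    (hfin.subset Set.sdiff_subset).isClosed.isOpen_compl.mem_nhds (by simp)
  obtain ⟨ε, hε, hball⟩ := Metric.mem_nhds_iff.1 hnhds
  refine (h1 ε hε).mono fun m hm => ?_
  have := hball (show x m ∈ Metric.ball (x n) ε by simpa [Real.dist_eq] using hm)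
  simpa using this

/-- A polynomial in two variables vanishing at `(a, t m)` for infinitely many `m`, where
`t → ∞`, vanishes on the whole line over `a`. -/
theorem eval_eq_zero_of_infinite {t : ℕ → ℝ}
    (h2 : Filter.Tendsto t Filter.atTop Filter.atTop) {f : MvPolynomial (Fin 2) ℝ}
    {v : Fin 2 → ℝ} {s : Set ℕ} (hs : s.Infinite)
    (hf : ∀ m ∈ s, MvPolynomial.eval ![v 0, t m] f = 0) : MvPolynomial.eval v f = 0 := by
  have heval := evalEval_aeval_fin_two f
  set p := MvPolynomial.aeval ![(Polynomial.C Polynomial.X : Polynomial (Polynomial ℝ)),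
    Polynomial.X] f
  have hmap (y : ℝ) : (p.map (Polynomial.evalRingHom (v 0))).eval y = p.evalEval (v 0) y :=
    Polynomial.map_evalRingHom_eval _ _ _
  have himage : (t '' s).Infinite := by
    intro hfin
    obtain ⟨M, hM⟩ := hfin.bddAbove
    obtain ⟨m, hm, hms⟩ := ((Nat.frequently_atTop_iff_infinite.2 hs).and_eventually
      (h2.eventually_gt_atTop M)).exists
    exact (hM ⟨m, hm, rfl⟩).not_gt hms
  have hzero : p.map (Polynomial.evalRingHom (v 0)) = 0 := by
    refine Polynomial.eq_zero_of_infinite_isRoot _ (himage.mono ?_)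
    rintro _ ⟨m, hm, rfl⟩
    exact (hmap _).trans ((heval ![v 0, t m]).trans (hf m hm))
  rw [← heval, ← hmap, hzero, Polynomial.eval_zero]

/-- If every `x n` is an accumulation point of the sequence `(x m)`
and `t n → ∞`, then the Zariski closure `V` of `{(x n, t n)}` in `ℝ²` is either all
of `ℝ²`, or `X = {x n}` is finite and `V = X × ℝ`. -/
theorem plane_closure_dichotomy (x t : ℕ → ℝ)
    (h1 : ∀ n : ℕ, ∀ ε : ℝ, 0 < ε → {m : ℕ | |x m - x n| < ε}.Infinite)
    (h2 : Filter.Tendsto t Filter.atTop Filter.atTop) :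
    zariskiClosure {v : Fin 2 → ℝ | ∃ n : ℕ, v = ![x n, t n]} = Set.univ
    ∨ ((Set.range x).Finite ∧
        zariskiClosure {v : Fin 2 → ℝ | ∃ n : ℕ, v = ![x n, t n]}
          = {v : Fin 2 → ℝ | v 0 ∈ Set.range x}) := by
  by_cases hV : zariskiClosure {v : Fin 2 → ℝ | ∃ n : ℕ, v = ![x n, t n]} = Set.univ
  · exact Or.inl hV
  obtain ⟨w, hw⟩ := (Set.ne_univ_iff_exists_notMem _).1 hV
  simp only [zariskiClosure, Set.mem_ofPred_eq, not_forall] at hw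
  obtain ⟨g, hg, hgw⟩ := hw
  have hfin : (Set.range x).Finite :=
    finite_range_of_eval_ne_zero h1 h2 (fun n => hg _ ⟨n, rfl⟩) hgw
  refine Or.inr ⟨hfin, Set.Subset.antisymm (fun v hv => ?_) ?_⟩
  · have hprod := hv (∏ a ∈ hfin.toFinset, (MvPolynomial.X 0 - MvPolynomial.C a)) (by
      rintro _ ⟨n, rfl⟩
      rw [map_prod]
      exact Finset.prod_eq_zero (hfin.mem_toFinset.2 ⟨n, rfl⟩) (by simp))
    rw [map_prod, Finset.prod_eq_zero_iff] at hprod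
    obtain ⟨a, ha, hva⟩ := hprod
    have hva' : v 0 = a := by simpa [sub_eq_zero] using hva
    rw [Set.mem_ofPred_eq, hva']
    exact hfin.mem_toFinset.1 ha
  · rintro v ⟨n, hn⟩ f hf
    refine eval_eq_zero_of_infinite h2 (infinite_setOf_eq_of_finite_range hfin (h1 n)) ?_
    intro m hm
    rw [← hn, ← show x m = x n from hm]
    exact hf _ ⟨m, rfl⟩
end

section
/- Let q be a minimal idempotent ultrafilter on ℕ, let p ∈ βℕ₀ + q (i.e. p = r + q for some ultrafilter r on ℕ₀), and let k ≥ 2 be an integer. Suppose x ∈ [0,1)^d is a point such that the sequence m ↦ {kᵐ x} (coordinatewise fractional part) converges to x along q, and V ⊆ ℝ^d × ℝ is an algebraic variety such that ({kⁿ x}, kⁿ) ∈ V for p-almost all n. Then for p-almost all n, the whole line {({kⁿ x}, t) : t ∈ ℝ} is contained in V. -/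
/-- The sum of two ultrafilters on `ℕ`: `E ∈ usum p q ↔ {n | {m | n + m ∈ E} ∈ q} ∈ p`. -/
def usum (p q : Ultrafilter ℕ) : Ultrafilter ℕ :=
  p.bind fun n => q.map fun m => n + m

/-- `algLim` of a sequence along an ultrafilter: the intersection over `I ∈ p` of the
Zariski closures of `{x n : n ∈ I}`. -/
def algLim {ι : Type} (x : ℕ → (ι → ℝ)) (p : Ultrafilter ℕ) : Set (ι → ℝ) :=
  ⋂ I ∈ p, zariskiClosure (x '' I)

open Filter Topology

theorem eventually_usum {p q : Ultrafilter ℕ} {P : ℕ → Prop} :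
    (∀ᶠ n in (usum p q : Filter ℕ), P n) ↔
      ∀ᶠ n in (p : Filter ℕ), ∀ᶠ m in (q : Filter ℕ), P (n + m) :=
  Iff.rfl

/-- A function with values in a finite set is eventually constant along an ultrafilter. -/
theorem Ultrafilter.exists_eventually_eq_of_finite {α β : Type*} (q : Ultrafilter α) (f : α → β)
    {s : Set β} (hs : s.Finite) (hf : ∀ a, f a ∈ s) :
    ∃ b, ∀ᶠ a in (q : Filter α), f a = b := by
  obtain ⟨b, -, hb⟩ := Ultrafilter.eq_pure_of_finite_mem (f := q.map f) hs
    (Ultrafilter.mem_map.2 (Filter.univ_mem' hf))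
  refine ⟨b, ?_⟩
  have h : ({b} : Set β) ∈ q.map f := by rw [hb]; exact Set.mem_singleton b
  exact h

namespace MvPolynomial

variable {ι : Type*}

/-- The polynomial `z ↦ h (b + c • z)`. -/
noncomputable def affineSubst (c : ℝ) (b : ι → ℝ) : MvPolynomial ι ℝ →ₐ[ℝ] MvPolynomial ι ℝ :=
  aeval fun i => C (b i) + C c * X i

theorem eval_affineSubst (c : ℝ) (b z : ι → ℝ) (h : MvPolynomial ι ℝ) :
    eval z (affineSubst c b h) = eval (b + c • z) h := by
  have : (aeval z).comp (affineSubst c b) = aeval (b + c • z) := by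
    ext i
    simp [affineSubst]
  simpa [aeval_eq_eval] using DFunLike.congr_fun this h

/-- A polynomial vanishing at infinitely many points of a line vanishes on the line. -/
theorem eval_line_eq_zero (h : MvPolynomial ι ℝ) (b v : ι → ℝ) {S : Set ℝ} (hS : S.Infinite)
    (h0 : ∀ s ∈ S, eval (b + s • v) h = 0) (s : ℝ) : eval (b + s • v) h = 0 := by
  let g : Polynomial ℝ :=
    aeval (fun i => Polynomial.C (b i) + Polynomial.X * Polynomial.C (v i)) h
  have hg (s : ℝ) : g.eval s = eval (b + s • v) h := by
    have : (Polynomial.aeval s).comp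
        (aeval fun i => Polynomial.C (b i) + Polynomial.X * Polynomial.C (v i)) =
        aeval (R := ℝ) (b + s • v) := by
      ext i
      simp [mul_comm s]
    simpa [g, aeval_eq_eval, Polynomial.coe_aeval_eq_eval] using DFunLike.congr_fun this h
  have : g = 0 := Polynomial.eq_zero_of_infinite_isRoot g
    (hS.mono fun s hs => (hg s).trans (h0 s hs))
  rw [← hg, this, Polynomial.eval_zero]

/-- The polynomials that vanish along `γ` for almost all indices. -/
def eventualVanishingIdeal {α : Type*} (l : Filter α) (γ : α → ι → ℝ) :
    Ideal (MvPolynomial ι ℝ) where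
  carrier := {h | ∀ᶠ a in l, eval (γ a) h = 0}
  add_mem' {f g} hf hg := by
    filter_upwards [hf, hg] with a h1 h2
    rw [map_add, h1, h2, add_zero]
  zero_mem' := Eventually.of_forall fun a => map_zero _
  smul_mem' c f hf := by
    filter_upwards [hf] with a h1
    rw [smul_eq_mul, map_mul, h1, mul_zero]

theorem mem_eventualVanishingIdeal {α : Type*} {l : Filter α} {γ : α → ι → ℝ}
    {h : MvPolynomial ι ℝ} :
    h ∈ eventualVanishingIdeal l γ ↔ ∀ᶠ a in l, eval (γ a) h = 0 :=
  Iff.rfl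

/-- If each element of an ideal `I` of a Noetherian ring is eventually sent into `J` by a family of
ring homomorphisms, then eventually all of `I` is. -/
theorem eventually_le_comap {α R S : Type*} [CommRing R] [IsNoetherianRing R] [CommRing S]
    {l : Filter α} {I : Ideal R} {J : Ideal S} {φ : α → R →+* S}
    (h : ∀ f ∈ I, ∀ᶠ a in l, φ a f ∈ J) : ∀ᶠ a in l, I ≤ J.comap (φ a) := by
  obtain ⟨s, rfl⟩ := IsNoetherian.noetherian I
  have : ∀ᶠ a in l, ∀ f ∈ s, φ a f ∈ J :=
    (Finset.eventually_all s).2 fun f hf => h f (Ideal.subset_span hf)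
  filter_upwards [this] with a ha
  exact Ideal.span_le.2 ha

variable [Finite ι]

/-- If `γ (m + l) = e m + k ^ m • γ l` along an idempotent ultrafilter along which `e` tends to `0`,
then every polynomial that vanishes along `γ` vanishes on the lines joining `e m` and `γ m`. -/
theorem eventually_eval_line_eq_zero {k : ℕ} (hk : 2 ≤ k) {q : Ultrafilter ℕ}
    (hq : usum q q = q) (hpos : ∀ᶠ m in (q : Filter ℕ), 1 ≤ m) {e γ : ℕ → ι → ℝ}
    (he : Tendsto e q (𝓝 0))
    (hγ : ∀ᶠ m in (q : Filter ℕ), ∀ᶠ l in (q : Filter ℕ), γ (m + l) = e m + (k : ℝ) ^ m • γ l) :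
    ∀ᶠ m in (q : Filter ℕ), ∀ h ∈ eventualVanishingIdeal (q : Filter ℕ) γ, ∀ t : ℝ,
      eval (e m + t • (γ m - e m)) h = 0 := by
  have := Fintype.ofFinite ι
  set I := eventualVanishingIdeal (q : Filter ℕ) γ with hI
  have hE : ∀ᶠ m in (q : Filter ℕ), ∀ h ∈ I, eval (γ m) h = 0 := by
    have := eventually_le_comap (l := (q : Filter ℕ)) (I := I) (J := (⊥ : Ideal ℝ))
      (φ := fun m => eval (γ m)) fun f hf => hf
    simpa [SetLike.le_def] using this
  have hL : ∀ᶠ m in (q : Filter ℕ), ∀ h ∈ I, affineSubst ((k : ℝ) ^ m) (e m) h ∈ I := by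
    refine eventually_le_comap (l := (q : Filter ℕ)) (I := I) (J := I)
      (φ := fun m => (affineSubst ((k : ℝ) ^ m) (e m)).toRingHom) fun f hf => ?_
    have hf' : ∀ᶠ n in (usum q q : Filter ℕ), eval (γ n) f = 0 := by rw [hq]; exact hf
    filter_upwards [eventually_usum.1 hf', hγ] with m h1 h2
    change ∀ᶠ l in (q : Filter ℕ), eval (γ l) (affineSubst ((k : ℝ) ^ m) (e m) f) = 0
    filter_upwards [h1, h2] with l h3 h4
    rw [eval_affineSubst, ← h4, h3]
  have hk1 (m : ℕ) (hm : 1 ≤ m) : (2 : ℝ) ≤ (k : ℝ) ^ m := by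
    exact_mod_cast hk.trans (Nat.le_self_pow (by omega) k)
  have hc0 : Tendsto (fun m => (1 - (k : ℝ) ^ m)⁻¹ • e m) q (𝓝 0) := by
    refine squeeze_zero_norm' ?_ (tendsto_zero_iff_norm_tendsto_zero.1 he)
    filter_upwards [hpos] with m hm
    rw [norm_smul, norm_inv, Real.norm_eq_abs]
    have := hk1 m hm
    refine mul_le_of_le_one_left (norm_nonneg _) (inv_le_one_of_one_le₀ ?_)
    rw [abs_of_neg (by linarith)]
    linarith
  have hscale (h : MvPolynomial ι ℝ) (hh : h ∈ I) (s : ℝ) : affineSubst s 0 h ∈ I := by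
    rw [hI, mem_eventualVanishingIdeal]
    filter_upwards [hE] with l hl
    rw [eval_affineSubst, zero_add]
    have key : ∀ᶠ m in (q : Filter ℕ),
        eval ((1 - (k : ℝ) ^ m)⁻¹ • e m + s • (γ l - (1 - (k : ℝ) ^ m)⁻¹ • e m)) h = 0 := by
      filter_upwards [hL, hpos] with m hm hm1
      have hK := hk1 m hm1
      set K := (k : ℝ) ^ m
      set c := (1 - K)⁻¹ • e m with hc
      have hec : e m = (1 - K) • c := by
        rw [hc, smul_smul, mul_inv_cancel₀ (by linarith), one_smul]
      have hN (N : ℕ) : affineSubst (K ^ N) ((1 - K ^ N) • c) h ∈ I := by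
        induction N with
        | zero =>
          rw [hI, mem_eventualVanishingIdeal]
          filter_upwards [hh] with j hj
          simpa [eval_affineSubst] using hj
        | succ N ih =>
          have := hm _ ih
          rw [hI, mem_eventualVanishingIdeal] at this ⊢
          filter_upwards [this] with j hj
          rw [eval_affineSubst, eval_affineSubst, hec] at hj
          rw [eval_affineSubst, ← hj]
          congr 2
          ext i
          simp only [Pi.add_apply, Pi.smul_apply, smul_eq_mul]
          ring
      refine eval_line_eq_zero h c (γ l - c) (S := Set.range fun N : ℕ => K ^ N)
        (Set.infinite_range_of_injective (pow_right_injective₀ (by linarith) (by linarith)))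
        ?_ s
      rintro _ ⟨N, rfl⟩
      have := hl _ (hN N)
      rw [eval_affineSubst] at this
      rw [← this]
      congr 2
      ext i
      simp only [Pi.add_apply, Pi.sub_apply, Pi.smul_apply, smul_eq_mul]
      ring
    have hlim := ((continuous_eval h).tendsto _).comp
      (hc0.add ((tendsto_const_nhds (x := γ l)).sub hc0 |>.const_smul s))
    rw [zero_add, sub_zero] at hlim
    exact tendsto_nhds_unique (hlim.congr' key) tendsto_const_nhds
  filter_upwards [hE, hL, hpos] with m hmE hmL hm1 h hh
  have hK := hk1 m hm1
  have htrans (N : ℕ) : affineSubst 1 ((N : ℝ) • e m) h ∈ I := by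
    induction N with
    | zero =>
      rw [hI, mem_eventualVanishingIdeal]
      filter_upwards [hh] with j hj
      simpa [eval_affineSubst] using hj
    | succ N ih =>
      have := hscale _ (hmL _ ih) ((k : ℝ) ^ m)⁻¹
      rw [hI, mem_eventualVanishingIdeal] at this ⊢
      filter_upwards [this] with j hj
      rw [eval_affineSubst, eval_affineSubst, eval_affineSubst, zero_add, smul_smul,
        mul_inv_cancel₀ (by linarith)] at hj
      rw [eval_affineSubst, ← hj]
      congr 2
      ext i
      simp only [Pi.add_apply, Pi.smul_apply, smul_eq_mul]
      push_cast
      ring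
  refine eval_line_eq_zero h _ _ (S := Set.range fun N : ℕ => 1 - (N : ℝ))
    (Set.infinite_range_of_injective fun a b hab => by simpa using hab) ?_
  rintro _ ⟨N, rfl⟩
  have := hmE _ (hscale _ (htrans N) (1 - N))
  rw [eval_affineSubst, eval_affineSubst] at this
  rw [← this]
  congr 2
  ext i
  simp only [Pi.add_apply, Pi.sub_apply, Pi.smul_apply, Pi.zero_apply, smul_eq_mul]
  ring

end MvPolynomial

theorem fract_pow_add (k : ℕ) (n m : ℕ) (x : ℝ) :
    Int.fract ((k : ℝ) ^ (n + m) * x) =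
      (k : ℝ) ^ n * Int.fract ((k : ℝ) ^ m * x) -
        ⌊(k : ℝ) ^ n * Int.fract ((k : ℝ) ^ m * x)⌋ := by
  rw [Int.self_sub_floor, Int.fract_eq_fract]
  refine ⟨k ^ n * ⌊(k : ℝ) ^ m * x⌋, ?_⟩
  rw [Int.fract]
  push_cast
  ring

theorem exists_eventually_fract_pow_add_eq {ι : Type*} [Finite ι] (k n : ℕ) (q : Ultrafilter ℕ)
    (x : ι → ℝ) :
    ∃ a : ι → ℤ, ∀ᶠ m in (q : Filter ℕ), ∀ i,
      Int.fract ((k : ℝ) ^ (n + m) * x i) = (k : ℝ) ^ n * Int.fract ((k : ℝ) ^ m * x i) - a i := by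
  have (i : ι) : ∃ a : ℤ, ∀ᶠ m in (q : Filter ℕ),
      ⌊(k : ℝ) ^ n * Int.fract ((k : ℝ) ^ m * x i)⌋ = a := by
    refine q.exists_eventually_eq_of_finite _ (Set.finite_Icc (0 : ℤ) (k ^ n)) fun m => ?_
    have h0 := Int.fract_nonneg ((k : ℝ) ^ m * x i)
    have h1 := (Int.fract_lt_one ((k : ℝ) ^ m * x i)).le
    refine ⟨Int.floor_nonneg.2 (by positivity), Int.cast_le (R := ℝ) |>.1 ?_⟩
    push_cast
    exact (Int.floor_le _).trans (mul_le_of_le_one_right (by positivity) h1)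
  choose a ha using this
  refine ⟨a, ?_⟩
  filter_upwards [eventually_all.2 ha] with m hm i
  rw [fract_pow_add, hm i]

/-- Recurrence along an idempotent ultrafilter makes the displacement `{kᵐ x} - x` a cocycle. -/
theorem eventually_fract_pow_add_sub_eq {ι : Type*} [Finite ι] {k : ℕ} {q : Ultrafilter ℕ}
    (hq : usum q q = q) {x : ι → ℝ} (hx : ∀ i, x i < 1)
    (hrec : ∀ i, Tendsto (fun m => Int.fract ((k : ℝ) ^ m * x i)) q (𝓝 (x i))) :
    ∀ᶠ n in (q : Filter ℕ), ∀ᶠ m in (q : Filter ℕ), ∀ i,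
      Int.fract ((k : ℝ) ^ (n + m) * x i) - x i =
        (Int.fract ((k : ℝ) ^ n * x i) - x i) +
          (k : ℝ) ^ n * (Int.fract ((k : ℝ) ^ m * x i) - x i) := by
  have hlt : ∀ᶠ n in (usum q q : Filter ℕ), ∀ i,
      Int.fract ((k : ℝ) ^ n * x i) < (1 + x i) / 2 := by
    rw [hq]
    exact eventually_all.2 fun i => (hrec i).eventually_lt_const (by linarith [hx i])
  filter_upwards [eventually_usum.1 hlt] with n hn
  obtain ⟨a, ha⟩ := exists_eventually_fract_pow_add_eq k n q x
  have hfract (i : ι) : Int.fract ((k : ℝ) ^ n * x i) = (k : ℝ) ^ n * x i - a i := by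
    have hlim := ((hrec i).const_mul ((k : ℝ) ^ n)).sub_const (a i : ℝ)
    rw [Int.fract_eq_iff]
    refine ⟨ge_of_tendsto hlim ?_, (le_of_tendsto hlim (b := (1 + x i) / 2) ?_).trans_lt
      (by linarith [hx i]), a i, by ring⟩
    · filter_upwards [ha] with m hm
      rw [← hm i]
      exact Int.fract_nonneg _
    · filter_upwards [ha, hn] with m hm hm'
      rw [← hm i]
      exact (hm' i).le
  filter_upwards [ha] with m hm i
  rw [hm i, hfract i]
  ring

/-- Let `q` be a minimal idempotent ultrafilter, `p ∈ βℕ₀ + q`,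
`k ≥ 2`, and `x ∈ [0,1)^d` with `{kᵐ x} → x` along `q`. If an algebraic variety
`V ⊆ ℝ^d × ℝ` contains `({kⁿ x}, kⁿ)` for `p`-almost all `n`, then for `p`-almost
all `n` the whole line `{({kⁿ x}, t) : t ∈ ℝ}` lies in `V`. -/
theorem variable_separation_times_k (d k : ℕ) (hk : 2 ≤ k)
    (q : Ultrafilter ℕ) (hqidem : usum q q = q)
    (hqmin : ∀ r : Ultrafilter ℕ, ∃ s : Ultrafilter ℕ, usum s (usum r q) = q)
    (p : Ultrafilter ℕ) (hp : ∃ r : Ultrafilter ℕ, p = usum r q)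
    (x : Fin d → ℝ) (hx : ∀ i, x i ∈ Set.Ico (0 : ℝ) 1)
    (hrec : Filter.Tendsto
      (fun m => fun i => Int.fract ((k : ℝ) ^ m * x i)) ↑q (nhds x))
    (V : Set (Fin (d + 1) → ℝ)) (hV : IsAlgVariety V)
    (hmem : ∀ᶠ n in ↑p,
      Fin.snoc (fun i => Int.fract ((k : ℝ) ^ n * x i)) ((k : ℝ) ^ n) ∈ V) :
    ∀ᶠ n in ↑p, ∀ t : ℝ,
      Fin.snoc (fun i => Int.fract ((k : ℝ) ^ n * x i)) t ∈ V := by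
  obtain ⟨F, rfl⟩ := hV
  obtain ⟨r, rfl⟩ := hp
  have hpos : ∀ᶠ m in (q : Filter ℕ), 1 ≤ m := by
    obtain ⟨s, hs⟩ := hqmin (pure 1)
    rw [← hs, eventually_usum]
    refine Eventually.of_forall fun n => eventually_usum.2 ?_
    change ∀ᶠ l in (q : Filter ℕ), 1 ≤ n + (1 + l)
    exact Eventually.of_forall fun l => by omega
  have hreci := tendsto_pi_nhds.1 hrec
  let e (m : ℕ) : Fin (d + 1) → ℝ := Fin.snoc (fun i => Int.fract ((k : ℝ) ^ m * x i) - x i) 0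
  let γ (m : ℕ) : Fin (d + 1) → ℝ :=
    Fin.snoc (fun i => Int.fract ((k : ℝ) ^ m * x i) - x i) ((k : ℝ) ^ m)
  have he : Tendsto e q (𝓝 0) := by
    refine tendsto_pi_nhds.2 fun i => ?_
    induction i using Fin.lastCases with
    | last => simp [e]
    | cast i => simpa [e] using (hreci i).sub_const (x i)
  have hγ : ∀ᶠ m in (q : Filter ℕ), ∀ᶠ l in (q : Filter ℕ),
      γ (m + l) = e m + (k : ℝ) ^ m • γ l := by
    filter_upwards [eventually_fract_pow_add_sub_eq hqidem (fun i => (hx i).2) hreci] with m hm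
    filter_upwards [hm] with l hl
    ext i
    induction i using Fin.lastCases with
    | last => simp [e, γ, pow_add]
    | cast i => simpa [e, γ] using hl i
  have hline := MvPolynomial.eventually_eval_line_eq_zero hk hqidem hpos he hγ
  rw [eventually_usum] at hmem ⊢
  filter_upwards [hmem] with n hn
  obtain ⟨a, ha⟩ := exists_eventually_fract_pow_add_eq k n q x
  have hk0 : (k : ℝ) ≠ 0 := by positivity
  let b : Fin (d + 1) → ℝ := Fin.snoc (fun i => (k : ℝ) ^ n * x i - a i) 0
  have hmemI : ∀ f ∈ F, MvPolynomial.affineSubst ((k : ℝ) ^ n) b f ∈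
      MvPolynomial.eventualVanishingIdeal (q : Filter ℕ) γ := by
    intro f hf
    rw [MvPolynomial.mem_eventualVanishingIdeal]
    filter_upwards [hn, ha] with m hm ham
    rw [MvPolynomial.eval_affineSubst, ← hm f hf]
    congr 2
    ext i
    induction i using Fin.lastCases with
    | last => simp [b, γ, pow_add]
    | cast i =>
      simp only [b, γ, Pi.add_apply, Pi.smul_apply, Fin.snoc_castSucc, ham i, smul_eq_mul]
      ring
  filter_upwards [hline, ha] with m hm ham t f hf
  have h := hm _ (hmemI f hf) (t / (k : ℝ) ^ (n + m))
  rw [MvPolynomial.eval_affineSubst] at h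
  rw [← h]
  congr 2
  ext i
  induction i using Fin.lastCases with
  | last =>
    simp [b, γ, e, pow_add]
    field_simp
  | cast i =>
    simp only [b, γ, e, Pi.add_apply, Pi.sub_apply, Pi.smul_apply, Fin.snoc_castSucc, ham i,
      smul_eq_mul]
    ring
end

section
/- Let (S_n)_{n∈ℕ} be a sequence of semialgebraic sets in ℝ^d with sup_n complexity(S_n) < ∞, and let p be an ultrafilter on ℕ. Then the set lim_{n→p} S_n := {x ∈ ℝ^d : x ∈ S_n for p-almost all n} is semialgebraic. -/
/-- The basic semialgebraic set determined by equations `F` and strict inequalities `G`. -/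
def basicSemialg {ι : Type} (F G : Finset (MvPolynomial ι ℝ)) : Set (ι → ℝ) :=
  {x | (∀ f ∈ F, MvPolynomial.eval x f = 0) ∧ (∀ g ∈ G, 0 < MvPolynomial.eval x g)}

/-- A semialgebraic set: a finite union of basic semialgebraic sets. -/
def IsSemialgebraic {ι : Type} (S : Set (ι → ℝ)) : Prop :=
  ∃ (r : ℕ) (F G : Fin r → Finset (MvPolynomial ι ℝ)),
    S = ⋃ i, basicSemialg (F i) (G i)

open Filter Topology

namespace IsSemialgebraic

variable {ι : Type}

theorem basic (F G : Finset (MvPolynomial ι ℝ)) : IsSemialgebraic (basicSemialg F G) :=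
  ⟨1, fun _ => F, fun _ => G, (Set.iUnion_const _).symm⟩

theorem of_iUnion_basic {κ : Type*} [Finite κ] (F G : κ → Finset (MvPolynomial ι ℝ)) :
    IsSemialgebraic (⋃ k, basicSemialg (F k) (G k)) := by
  obtain ⟨r, ⟨e⟩⟩ := Finite.exists_equiv_fin κ
  exact ⟨r, F ∘ e.symm, G ∘ e.symm,
    (e.symm.surjective.iUnion_comp fun k => basicSemialg (F k) (G k)).symm⟩

theorem univ : IsSemialgebraic (Set.univ : Set (ι → ℝ)) := by
  simpa [basicSemialg] using basic (∅ : Finset (MvPolynomial ι ℝ)) ∅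

theorem empty : IsSemialgebraic (∅ : Set (ι → ℝ)) :=
  ⟨0, Fin.elim0, Fin.elim0, by simp⟩

theorem eval_eq_zero (f : MvPolynomial ι ℝ) :
    IsSemialgebraic {x | MvPolynomial.eval x f = 0} := by
  simpa [basicSemialg] using basic {f} ∅

theorem eval_pos (f : MvPolynomial ι ℝ) :
    IsSemialgebraic {x | 0 < MvPolynomial.eval x f} := by
  simpa [basicSemialg] using basic ∅ {f}

theorem iUnion {κ : Type*} [Finite κ] {S : κ → Set (ι → ℝ)}
    (hS : ∀ k, IsSemialgebraic (S k)) : IsSemialgebraic (⋃ k, S k) := by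
  choose r F G h using hS
  have := of_iUnion_basic (fun q : Σ k, Fin (r k) => F q.1 q.2) (fun q => G q.1 q.2)
  rwa [Set.iUnion_sigma, ← Set.iUnion_congr h] at this

theorem union {S T : Set (ι → ℝ)} (hS : IsSemialgebraic S) (hT : IsSemialgebraic T) :
    IsSemialgebraic (S ∪ T) := by
  rw [Set.union_eq_iUnion]
  exact iUnion fun b => by cases b <;> assumption

theorem inter {S T : Set (ι → ℝ)} (hS : IsSemialgebraic S) (hT : IsSemialgebraic T) :
    IsSemialgebraic (S ∩ T) := by
  classical
  obtain ⟨r, F, G, rfl⟩ := hS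
  obtain ⟨r', F', G', rfl⟩ := hT
  simp only [Set.iUnion_inter, Set.inter_iUnion]
  refine iUnion fun j => iUnion fun i => ?_
  convert basic (F i ∪ F' j) (G i ∪ G' j) using 1
  ext x
  simp only [basicSemialg, Set.mem_inter_iff, Set.mem_ofPred_eq, Finset.mem_union, or_imp,
    forall_and]
  tauto

theorem iInter_fin {m : ℕ} {S : Fin m → Set (ι → ℝ)}
    (hS : ∀ k, IsSemialgebraic (S k)) : IsSemialgebraic (⋂ k, S k) := by
  induction m with
  | zero => simpa using univ
  | succ m ih =>
    have : ⋂ k, S k = S 0 ∩ ⋂ k : Fin m, S k.succ := by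
      ext x; simp [Fin.forall_fin_succ]
    rw [this]
    exact (hS 0).inter (ih fun k => hS k.succ)

end IsSemialgebraic

theorem Ultrafilter.exists_tendsto_of_eventually_mem {α X : Type*} [TopologicalSpace X]
    (p : Ultrafilter α) {K : Set X} (hK : IsCompact K) {b : α → X} (hb : ∀ᶠ n in p, b n ∈ K) :
    ∃ β, Tendsto b p (𝓝 β) := by
  obtain ⟨β, -, h⟩ := hK.ultrafilter_le_nhds (p.map b) (le_principal_iff.2 hb)
  exact ⟨β, h⟩

theorem Ultrafilter.eventually_exists_fintype {α κ : Type*} [Finite κ] (p : Ultrafilter α)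
    {P : α → κ → Prop} : (∀ᶠ n in p, ∃ k, P n k) ↔ ∃ k, ∀ᶠ n in p, P n k := by
  have h := Ultrafilter.finite_biUnion_mem_iff (f := p) (Set.finite_univ (α := κ))
    (s := fun k => {n | P n k})
  simpa [Filter.Eventually, Set.ofPred_exists] using h

/-- The limit of the zero sets, and of the positivity sets, of linear combinations of finitely
many fixed polynomials is semialgebraic. -/
theorem isSemialgebraic_limit_linearCombination {α ι κ : Type} (p : Ultrafilter α)
    (h : κ → MvPolynomial ι ℝ) (s : Finset κ) (a : α → κ → ℝ) :
    IsSemialgebraic {x | ∀ᶠ n in p, ∑ j ∈ s, a n j * MvPolynomial.eval x (h j) = 0} ∧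
    IsSemialgebraic {x | ∀ᶠ n in p, 0 < ∑ j ∈ s, a n j * MvPolynomial.eval x (h j)} := by
  classical
  induction s using Finset.strongInduction generalizing a with
  | H s ih =>
  by_cases h0 : ∀ᶠ n in p, ∀ j ∈ s, a n j = 0
  · have hf : ∀ x, ∀ᶠ n in p, ∑ j ∈ s, a n j * MvPolynomial.eval x (h j) = 0 := fun x => by
      filter_upwards [h0] with n hn
      exact Finset.sum_eq_zero fun j hj => by rw [hn j hj, zero_mul]
    constructor
    · simpa only [hf, Set.ofPred_true] using IsSemialgebraic.univ
    · convert IsSemialgebraic.empty using 1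
      refine Set.eq_empty_of_forall_notMem fun x hx => ?_
      obtain ⟨n, h1, h2⟩ := ((hf x).and hx).exists
      exact h2.ne' h1
  · have hmax : ∀ᶠ n in p, ∃ j : s, a n j ≠ 0 ∧ ∀ i ∈ s, |a n i| ≤ |a n j| := by
      filter_upwards [Ultrafilter.eventually_not.2 h0] with n hn
      push Not at hn
      obtain ⟨i, hi, hai⟩ := hn
      obtain ⟨j, hj, hmax⟩ := s.exists_max_image (fun i => |a n i|) ⟨i, hi⟩
      exact ⟨⟨j, hj⟩, abs_pos.1 ((abs_pos.2 hai).trans_le (hmax i hi)), hmax⟩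
    obtain ⟨⟨j₀, hj₀⟩, hmax⟩ := p.eventually_exists_fintype.1 hmax
    have hlim : ∀ j, ∃ β, j ∈ s → Tendsto (fun n => a n j / |a n j₀|) p (𝓝 β) := fun j => by
      by_cases hj : j ∈ s
      · obtain ⟨β, hβ⟩ := p.exists_tendsto_of_eventually_mem
          (isCompact_Icc (a := (-1 : ℝ)) (b := 1)) (b := fun n => a n j / |a n j₀|) (by
            filter_upwards [hmax] with n hn
            rw [Set.mem_Icc, ← abs_le, abs_div, abs_abs]
            exact div_le_one_of_le₀ (hn.2 j hj) (abs_nonneg _))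
        exact ⟨β, fun _ => hβ⟩
      · exact ⟨0, fun hj' => absurd hj' hj⟩
    choose β hβ using hlim
    have hβ₀ : β j₀ ≠ 0 := by
      have h1 : Tendsto (fun n => |(a n j₀ / |a n j₀|)|) p (𝓝 1) := by
        refine tendsto_const_nhds.congr' ?_
        filter_upwards [hmax] with n hn
        rw [abs_div, abs_abs, div_self (abs_ne_zero.2 hn.1)]
      have := tendsto_nhds_unique (hβ j₀ hj₀).abs h1
      intro h2
      simp [h2] at this
    set u : MvPolynomial ι ℝ := ∑ j ∈ s, MvPolynomial.C (β j) * h j with hu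
    have hux : ∀ x, MvPolynomial.eval x u = ∑ j ∈ s, β j * MvPolynomial.eval x (h j) :=
      fun x => by simp [hu]
    have htend : ∀ x, Tendsto (fun n => (∑ j ∈ s, a n j * MvPolynomial.eval x (h j)) / |a n j₀|)
        p (𝓝 (MvPolynomial.eval x u)) := fun x => by
      rw [hux]
      simp only [Finset.sum_div, mul_div_right_comm]
      exact tendsto_finsetSum _ fun j hj => (hβ j hj).mul_const _
    have hpos : ∀ x, 0 < MvPolynomial.eval x u →
        ∀ᶠ n in p, 0 < ∑ j ∈ s, a n j * MvPolynomial.eval x (h j) := fun x hx => by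
      filter_upwards [(htend x).eventually_const_lt hx, hmax] with n h1 h2
      exact (div_pos_iff_of_pos_right (abs_pos.2 h2.1)).1 h1
    have hneg : ∀ x, MvPolynomial.eval x u < 0 →
        ∀ᶠ n in p, ∑ j ∈ s, a n j * MvPolynomial.eval x (h j) < 0 := fun x hx => by
      filter_upwards [(htend x).eventually_lt_const hx, hmax] with n h1 h2
      by_contra! h3
      exact h1.not_ge (div_nonneg h3 (abs_nonneg _))
    set a' : α → κ → ℝ := fun n j => a n j - a n j₀ / β j₀ * β j with ha'
    have hzero : ∀ x, MvPolynomial.eval x u = 0 → ∀ n,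
        ∑ j ∈ s, a n j * MvPolynomial.eval x (h j) =
          ∑ j ∈ s.erase j₀, a' n j * MvPolynomial.eval x (h j) := fun x hx n => by
      rw [Finset.sum_erase _ (by simp [ha', hβ₀])]
      simp only [ha', sub_mul, Finset.sum_sub_distrib, mul_assoc, ← Finset.mul_sum]
      rw [← hux, hx, mul_zero, sub_zero]
    obtain ⟨ihz, ihp⟩ := ih _ (Finset.erase_ssubset hj₀) a'
    constructor
    · convert (IsSemialgebraic.eval_eq_zero u).inter ihz using 1
      ext x
      simp only [Set.mem_ofPred_eq, Set.mem_inter_iff]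
      rcases lt_trichotomy (MvPolynomial.eval x u) 0 with hx | hx | hx
      · refine iff_of_false (fun h1 => ?_) fun h1 => hx.ne h1.1
        obtain ⟨n, h1, h2⟩ := (h1.and (hneg x hx)).exists
        exact h2.ne h1
      · simp [hx, hzero x hx]
      · refine iff_of_false (fun h1 => ?_) fun h1 => hx.ne' h1.1
        obtain ⟨n, h1, h2⟩ := (h1.and (hpos x hx)).exists
        exact h2.ne' h1
    · convert (IsSemialgebraic.eval_pos u).union
        ((IsSemialgebraic.eval_eq_zero u).inter ihp) using 1
      ext x
      simp only [Set.mem_ofPred_eq, Set.mem_inter_iff, Set.mem_union]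
      rcases lt_trichotomy (MvPolynomial.eval x u) 0 with hx | hx | hx
      · refine iff_of_false (fun h1 => ?_) fun h1 => ?_
        · obtain ⟨n, h1, h2⟩ := (h1.and (hneg x hx)).exists
          exact h2.not_gt h1
        · rcases h1 with h1 | h1
          · exact hx.not_gt h1
          · exact hx.ne h1.1
      · simp [hx, hzero x hx]
      · exact iff_of_true (hpos x hx) (Or.inl hx)

theorem isSemialgebraic_limit_of_totalDegree_le {α : Type} {d : ℕ} (p : Ultrafilter α) (D : ℕ)
    (f : α → MvPolynomial (Fin d) ℝ) (hf : ∀ n, (f n).totalDegree ≤ D) :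
    IsSemialgebraic {x | ∀ᶠ n in p, MvPolynomial.eval x (f n) = 0} ∧
    IsSemialgebraic {x | ∀ᶠ n in p, 0 < MvPolynomial.eval x (f n)} := by
  classical
  set s := (Finsupp.finite_of_degree_le (σ := Fin d) D).toFinset with hs
  have key : ∀ n x, MvPolynomial.eval x (f n) = ∑ m ∈ s, MvPolynomial.coeff m (f n) *
      MvPolynomial.eval x (MvPolynomial.monomial m (1 : ℝ)) := fun n x => by
    rw [MvPolynomial.eval_eq']
    have hsub : (f n).support ⊆ s := fun m hm => by
      simp only [hs, Set.Finite.mem_toFinset, Set.mem_ofPred_eq]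
      exact (MvPolynomial.le_totalDegree hm).trans (hf n)
    rw [← Finset.sum_subset hsub fun m _ hm => by
      rw [MvPolynomial.notMem_support_iff.1 hm, zero_mul]]
    refine Finset.sum_congr rfl fun m _ => ?_
    rw [MvPolynomial.eval_monomial, one_mul, Finsupp.prod_fintype _ _ (by simp)]
  simp only [key]
  exact isSemialgebraic_limit_linearCombination p _ s fun n m => MvPolynomial.coeff m (f n)

/-- A finite set with at most `m` elements can be listed by `Fin m`, padding with `a`. -/
theorem Finset.exists_fin_enumeration {α : Type*} (s : Finset α) {m : ℕ} (hs : s.card ≤ m)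
    (a : α) : ∃ P : Fin m → α, (∀ k, P k ∈ s ∨ P k = a) ∧ ∀ x ∈ s, ∃ k, P k = x := by
  refine ⟨fun k => s.toList.getD k a, fun k => ?_, fun x hx => ?_⟩
  · beta_reduce
    by_cases hk : (k : ℕ) < s.toList.length
    · left
      rw [List.getD_eq_getElem _ _ hk, ← Finset.mem_toList]
      exact List.getElem_mem hk
    · exact Or.inr (List.getD_eq_default _ _ (not_lt.1 hk))
  · obtain ⟨i, hi, rfl⟩ := List.getElem_of_mem (Finset.mem_toList.2 hx)
    exact ⟨⟨i, hi.trans_le (by simpa using hs)⟩, List.getD_eq_getElem _ _ hi⟩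

theorem Finset.card_filter_ne_zero_le_sum {α : Type*} (s : Finset α) (w : α → ℕ) :
    (s.filter fun x => w x ≠ 0).card ≤ ∑ x ∈ s, w x := by
  rw [Finset.card_filter]
  refine Finset.sum_le_sum fun x _ => ?_
  split_ifs with h
  · exact Nat.one_le_iff_ne_zero.2 h
  · exact Nat.zero_le _

/-- A set cut out by `m` equations and `m` strict inequalities, all of degree at most `m`. -/
def IsBasicOfSize {ι : Type} (m : ℕ) (T : Set (ι → ℝ)) : Prop :=
  ∃ P Q : Fin m → MvPolynomial ι ℝ,
    (∀ k, (P k).totalDegree ≤ m) ∧ (∀ k, (Q k).totalDegree ≤ m) ∧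
    T = {x | ∀ k, MvPolynomial.eval x (P k) = 0 ∧ 0 < MvPolynomial.eval x (Q k)}

theorem isBasicOfSize_empty {ι : Type} {m : ℕ} (hm : 0 < m) :
    IsBasicOfSize m (∅ : Set (ι → ℝ)) :=
  ⟨fun _ => 1, fun _ => 1, by simp, by simp, by
    ext x
    simpa using ⟨⟨0, hm⟩⟩⟩

theorem isBasicOfSize_univ {ι : Type} (m : ℕ) : IsBasicOfSize m (Set.univ : Set (ι → ℝ)) :=
  ⟨fun _ => 0, fun _ => 1, by simp, by simp, by simp⟩

theorem MvPolynomial.eval_eq_eval_of_totalDegree_eq_zero {ι R : Type*} [CommSemiring R]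
    {f : MvPolynomial ι R} (hf : f.totalDegree = 0) (x y : ι → R) :
    MvPolynomial.eval x f = MvPolynomial.eval y f := by
  rw [MvPolynomial.totalDegree_eq_zero_iff_eq_C.1 hf]
  simp

theorem basicSemialg_isBasicOfSize {ι : Type} {m : ℕ} (hm : 0 < m)
    {F G : Finset (MvPolynomial ι ℝ)}
    (h : F.sum MvPolynomial.totalDegree + G.sum MvPolynomial.totalDegree ≤ m) :
    IsBasicOfSize m (basicSemialg F G) := by
  classical
  rcases (basicSemialg F G).eq_empty_or_nonempty with h0 | ⟨y, hyF, hyG⟩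
  · rw [h0]
    exact isBasicOfSize_empty hm
  have hF : F.sum MvPolynomial.totalDegree ≤ m := (Nat.le_add_right _ _).trans h
  have hG : G.sum MvPolynomial.totalDegree ≤ m := (Nat.le_add_left _ _).trans h
  obtain ⟨P, hP, hP'⟩ := Finset.exists_fin_enumeration _
    ((F.card_filter_ne_zero_le_sum MvPolynomial.totalDegree).trans hF) 0
  obtain ⟨Q, hQ, hQ'⟩ := Finset.exists_fin_enumeration _
    ((G.card_filter_ne_zero_le_sum MvPolynomial.totalDegree).trans hG) 1
  refine ⟨P, Q, fun k => ?_, fun k => ?_, ?_⟩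
  · rcases hP k with hk | hk
    · exact (Finset.single_le_sum (f := MvPolynomial.totalDegree) (fun _ _ => Nat.zero_le _)
        (Finset.mem_filter.1 hk).1).trans hF
    · simp [hk]
  · rcases hQ k with hk | hk
    · exact (Finset.single_le_sum (f := MvPolynomial.totalDegree) (fun _ _ => Nat.zero_le _)
        (Finset.mem_filter.1 hk).1).trans hG
    · simp [hk]
  · ext x
    constructor
    · rintro ⟨hxF, hxG⟩ k
      constructor
      · rcases hP k with hk | hk
        · exact hxF _ (Finset.mem_filter.1 hk).1
        · simp [hk]
      · rcases hQ k with hk | hk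
        · exact hxG _ (Finset.mem_filter.1 hk).1
        · simp [hk]
    · intro hx
      constructor
      · intro f hf
        by_cases hd : f.totalDegree = 0
        · rw [MvPolynomial.eval_eq_eval_of_totalDegree_eq_zero hd x y, hyF f hf]
        · obtain ⟨k, rfl⟩ := hP' f (Finset.mem_filter.2 ⟨hf, hd⟩)
          exact (hx k).1
      · intro g hg
        by_cases hd : g.totalDegree = 0
        · rw [MvPolynomial.eval_eq_eval_of_totalDegree_eq_zero hd x y]
          exact hyG g hg
        · obtain ⟨k, rfl⟩ := hQ' g (Finset.mem_filter.2 ⟨hg, hd⟩)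
          exact (hx k).2

theorem basicSemialg_eq_univ_of_nonempty {ι : Type} {F G : Finset (MvPolynomial ι ℝ)}
    (h : F.sum MvPolynomial.totalDegree + G.sum MvPolynomial.totalDegree = 0)
    (hne : (basicSemialg F G).Nonempty) : basicSemialg F G = Set.univ := by
  obtain ⟨y, hyF, hyG⟩ := hne
  obtain ⟨hF, hG⟩ := Nat.add_eq_zero_iff.1 h
  rw [Finset.sum_eq_zero_iff] at hF hG
  refine Set.eq_univ_of_forall fun x => ⟨fun f hf => ?_, fun g hg => ?_⟩
  · rw [MvPolynomial.eval_eq_eval_of_totalDegree_eq_zero (hF f hf) x y, hyF f hf]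
  · rw [MvPolynomial.eval_eq_eval_of_totalDegree_eq_zero (hG g hg) x y]
    exact hyG g hg

/-- A semialgebraic set of complexity at most `C` is a union of `C + 1` basic sets of size
`C + 1`, although its given representation may involve any number of constant polynomials. -/
theorem exists_iUnion_isBasicOfSize {ι : Type} {C r : ℕ} {F G : Fin r → Finset (MvPolynomial ι ℝ)}
    (h : ∑ i, ((F i).sum MvPolynomial.totalDegree + (G i).sum MvPolynomial.totalDegree) ≤ C) :
    ∃ T : Fin (C + 1) → Set (ι → ℝ), (∀ k, IsBasicOfSize (C + 1) (T k)) ∧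
      ⋃ i, basicSemialg (F i) (G i) = ⋃ k, T k := by
  classical
  set w : Fin r → ℕ := fun i =>
    (F i).sum MvPolynomial.totalDegree + (G i).sum MvPolynomial.totalDegree with hw
  set E : Set (ι → ℝ) := ⋃ i : {i // w i = 0}, basicSemialg (F i) (G i) with hE
  have hEsize : IsBasicOfSize (C + 1) E := by
    rcases E.eq_empty_or_nonempty with h0 | ⟨y, hy⟩
    · rw [h0]
      exact isBasicOfSize_empty C.succ_pos
    · obtain ⟨i, hi⟩ := Set.mem_iUnion.1 hy
      have : E = Set.univ := Set.eq_univ_of_forall fun x => Set.mem_iUnion.2 ⟨i, by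
        rw [basicSemialg_eq_univ_of_nonempty i.2 ⟨y, hi⟩]
        trivial⟩
      rw [this]
      exact isBasicOfSize_univ _
  set J := insert E ((Finset.univ.filter fun i => w i ≠ 0).image
    fun i => basicSemialg (F i) (G i)) with hJ
  have hcard : J.card ≤ C + 1 := (Finset.card_insert_le _ _).trans <| Nat.succ_le_succ <|
    Finset.card_image_le.trans <| (Finset.card_filter_ne_zero_le_sum _ w).trans h
  obtain ⟨T, hT, hT'⟩ := J.exists_fin_enumeration hcard ∅
  refine ⟨T, fun k => ?_, ?_⟩
  · rcases hT k with hk | hk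
    · rcases Finset.mem_insert.1 hk with hk | hk
      · rwa [hk]
      · obtain ⟨i, -, hi⟩ := Finset.mem_image.1 hk
        rw [← hi]
        exact basicSemialg_isBasicOfSize C.succ_pos <|
          (Finset.single_le_sum (f := w) (fun _ _ => Nat.zero_le _) (Finset.mem_univ i)).trans
            (h.trans C.le_succ)
    · rw [hk]
      exact isBasicOfSize_empty C.succ_pos
  · apply Set.Subset.antisymm
    · refine Set.iUnion_subset fun i => ?_
      by_cases hi : w i = 0
      · obtain ⟨k, hk⟩ := hT' E (Finset.mem_insert_self _ _)
        refine Set.Subset.trans ?_ (Set.subset_iUnion T k)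
        rw [hk]
        exact Set.subset_iUnion (fun i : {i // w i = 0} => basicSemialg (F i) (G i)) ⟨i, hi⟩
      · obtain ⟨k, hk⟩ := hT' (basicSemialg (F i) (G i)) (Finset.mem_insert_of_mem
          (Finset.mem_image.2 ⟨i, Finset.mem_filter.2 ⟨Finset.mem_univ i, hi⟩, rfl⟩))
        rw [← hk]
        exact Set.subset_iUnion T k
    · refine Set.iUnion_subset fun k => ?_
      rcases hT k with hk | hk
      · rcases Finset.mem_insert.1 hk with hk | hk
        · rw [hk]
          exact Set.iUnion_subset fun i =>
            Set.subset_iUnion (fun i => basicSemialg (F i) (G i)) i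
        · obtain ⟨i, -, hi⟩ := Finset.mem_image.1 hk
          rw [← hi]
          exact Set.subset_iUnion (fun i => basicSemialg (F i) (G i)) i
      · rw [hk]
        exact Set.empty_subset _

/-- A limit along an ultrafilter of semialgebraic sets of uniformly
bounded complexity (i.e. each admitting a representation as a finite union of basic
semialgebraic sets with total degree sum at most `C`) is semialgebraic. -/
theorem semialgebraic_limit (d : ℕ) (S : ℕ → Set (Fin d → ℝ)) (p : Ultrafilter ℕ)
    (hS : ∃ C : ℕ, ∀ n : ℕ,
      ∃ (r : ℕ) (F G : Fin r → Finset (MvPolynomial (Fin d) ℝ)),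
        S n = ⋃ i, basicSemialg (F i) (G i) ∧
        ∑ i, ((F i).sum MvPolynomial.totalDegree
            + (G i).sum MvPolynomial.totalDegree) ≤ C) :
    IsSemialgebraic {x : Fin d → ℝ | ∀ᶠ n in ↑p, x ∈ S n} := by
  obtain ⟨C, hC⟩ := hS
  have hT : ∀ n, ∃ T : Fin (C + 1) → Set (Fin d → ℝ),
      (∀ k, IsBasicOfSize (C + 1) (T k)) ∧ S n = ⋃ k, T k := fun n => by
    obtain ⟨r, F, G, hSn, hsum⟩ := hC n
    obtain ⟨T, hT, hU⟩ := exists_iUnion_isBasicOfSize hsum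
    exact ⟨T, hT, hSn.trans hU⟩
  choose T hTsize hST using hT
  choose P Q hP hQ hTPQ using hTsize
  have key : {x : Fin d → ℝ | ∀ᶠ n in ↑p, x ∈ S n} = ⋃ k, ⋂ l,
      ({x | ∀ᶠ n in p, MvPolynomial.eval x (P n k l) = 0} ∩
        {x | ∀ᶠ n in p, 0 < MvPolynomial.eval x (Q n k l)}) := by
    ext x
    simp only [hST, hTPQ, Set.mem_ofPred_eq, Set.mem_iUnion, Set.mem_iInter, Set.mem_inter_iff,
      Ultrafilter.eventually_exists_fintype, Filter.eventually_all, Filter.eventually_and]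
  rw [key]
  exact IsSemialgebraic.iUnion fun k => IsSemialgebraic.iInter_fin fun l =>
    (isSemialgebraic_limit_of_totalDegree_le p _ (fun n => P n k l) fun n => hP n k l).1.inter
      (isSemialgebraic_limit_of_totalDegree_le p _ (fun n => Q n k l) fun n => hQ n k l).2
end

section
/- Let k ≥ 2 be an integer, let x ∈ ℝ^d, and let S ⊆ [0,1)^d be a semialgebraic set. Suppose that the set {n ∈ ℕ : {kⁿ x} ∈ S} is central, where {y} denotes the coordinatewise fractional part. Then the set {l ∈ ℕ : {l·kⁿ x} ∈ S for infinitely many n ∈ ℕ} is IP*₊. -/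
/-- Finite sums of a sequence over nonempty finite index sets. -/
def FS (a : ℕ → ℕ) : Set ℕ :=
  {m : ℕ | ∃ I : Finset ℕ, I.Nonempty ∧ m = ∑ i ∈ I, a i}

/-- A set is IP if it contains the finite sums of a sequence of positive integers. -/
def IsIP (A : Set ℕ) : Prop :=
  ∃ a : ℕ → ℕ, (∀ i, 0 < a i) ∧ FS a ⊆ A

/-- A set is IP* if it meets every IP set. -/
def IsIPStar (E : Set ℕ) : Prop :=
  ∀ A : Set ℕ, IsIP A → (E ∩ A).Nonempty

/-- A set is IP*₊ if some (integer) translate of it is an IP* set. -/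
def IsIPStarPlus (E : Set ℕ) : Prop :=
  ∃ t : ℤ, IsIPStar {n : ℕ | ∃ m ∈ E, (m : ℤ) = (n : ℤ) + t}

/-- Auxiliary predicate: `(X, T, x, y, U)` witnesses that `E` is central:
`T` is continuous, `(x, y)` is proximal, `y` is uniformly recurrent, `U` is an open
neighbourhood of `y`, and `E = {n : Tⁿ x ∈ U}`. -/
def CentralWitness (X : Type) [MetricSpace X] [CompactSpace X]
    (T : X → X) (x y : X) (U : Set X) (E : Set ℕ) : Prop :=
  Continuous T ∧
  (∀ ε : ℝ, 0 < ε → ∃ᶠ n in Filter.atTop, dist (T^[n] x) (T^[n] y) < ε) ∧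
  (∀ W : Set X, IsOpen W → y ∈ W →
    ∃ N : ℕ, ∀ m : ℕ, ∃ n : ℕ, m ≤ n ∧ n < m + N ∧ T^[n] y ∈ W) ∧
  IsOpen U ∧ y ∈ U ∧ E = {n : ℕ | T^[n] x ∈ U}

/-- A set `E ⊆ ℕ` is central. -/
def IsCentral (E : Set ℕ) : Prop :=
  ∃ (X : Type) (m : MetricSpace X)
    (c : @CompactSpace X m.toUniformSpace.toTopologicalSpace)
    (T : X → X) (x y : X) (U : Set X),
    @CentralWitness X m c T x y U E

open Filter Topology

/-- Additive idempotence of an ultrafilter on `ℕ`, in terms of iterated quantifiers. -/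
def IsAddIdem (p : Ultrafilter ℕ) : Prop :=
  ∀ P : ℕ → Prop, (∀ᶠ n in p, P n) ↔ ∀ᶠ m in p, ∀ᶠ n in p, P (m + n)

theorem exists_ultrafilter_of_frequently_lt {f : ℕ → ℝ}
    (hf : ∀ ε : ℝ, 0 < ε → ∀ N, ∃ n, N ≤ n ∧ f n < ε) :
    ∃ V : Ultrafilter ℕ, (∀ N, ∀ᶠ n in (V : Filter ℕ), N ≤ n) ∧
      ∀ ε : ℝ, 0 < ε → ∀ᶠ n in (V : Filter ℕ), f n < ε := by
  choose s hs1 hs2 using fun i : ℕ ↦ hf (1 / (i + 1 : ℝ)) (by positivity) i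
  refine ⟨(hyperfilter ℕ).map s, fun N ↦ ?_, fun ε hε ↦ ?_⟩ <;>
    rw [Ultrafilter.coe_map, eventually_map] <;>
    refine Nat.hyperfilter_le_atTop ?_
  · exact mem_atTop_sets.2 ⟨N, fun i hi ↦ hi.trans (hs1 i)⟩
  · have := tendsto_one_div_add_atTop_nhds_zero_nat (𝕜 := ℝ)
    exact (this.eventually_lt_const hε).mono fun i hi ↦ (hs2 i).trans hi

theorem exists_isAddIdem_of_isCentral {E : Set ℕ} (hE : IsCentral E) :
    ∃ p : Ultrafilter ℕ, (p : Filter ℕ) ≤ atTop ∧ IsAddIdem p ∧ ∀ᶠ n in p, n ∈ E := by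
  obtain ⟨X, _, _, T, x, y, U, hT, hprox, hrec, hU, hyU, rfl⟩ := hE
  let _ := Ultrafilter.addSemigroup (M := ℕ)
  let L : Set (Ultrafilter ℕ) := {q | (∀ N, ∀ᶠ n in (q : Filter ℕ), N ≤ n) ∧
    (∀ ε : ℝ, 0 < ε → ∀ᶠ n in (q : Filter ℕ), dist (T^[n] x) (T^[n] y) < ε) ∧
    ∀ ε : ℝ, 0 < ε → ∀ᶠ n in (q : Filter ℕ), dist (T^[n] y) y < ε}
  have hLclosed : IsClosed L := by
    have : L = (⋂ N, {q : Ultrafilter ℕ | {n | N ≤ n} ∈ q}) ∩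
        ((⋂ ε : ℝ, ⋂ _ : 0 < ε, {q : Ultrafilter ℕ | {n | dist (T^[n] x) (T^[n] y) < ε} ∈ q}) ∩
        (⋂ ε : ℝ, ⋂ _ : 0 < ε, {q : Ultrafilter ℕ | {n | dist (T^[n] y) y < ε} ∈ q})) := by
      ext q
      simp [L, Filter.Eventually]
    rw [this]
    refine (isClosed_iInter fun _ ↦ ultrafilter_isClosed_basic _).inter
      (IsClosed.inter ?_ ?_) <;>
    exact isClosed_iInter fun _ ↦ isClosed_iInter fun _ ↦ ultrafilter_isClosed_basic _
  -- continuity of the iterates turns closeness into closeness at a later time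
  have huc : ∀ (m : ℕ) (ε : ℝ), 0 < ε → ∃ δ > 0, ∀ v w, dist v w < δ →
      dist (T^[m] v) (T^[m] w) < ε := fun m ε hε ↦ by
    obtain ⟨δ, hδ, h⟩ := Metric.uniformContinuous_iff.1
      (CompactSpace.uniformContinuous_of_continuous (hT.iterate m)) ε hε
    exact ⟨δ, hδ, fun v w ↦ @h v w⟩
  have hLadd : ∀ q ∈ L, ∀ r ∈ L, q + r ∈ L := by
    rintro q ⟨hq1, hq2, hq3⟩ r ⟨hr1, hr2, hr3⟩
    refine ⟨fun N ↦ ?_, fun ε hε ↦ ?_, fun ε hε ↦ ?_⟩ <;> rw [Ultrafilter.eventually_add]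
    · exact (hq1 N).mono fun m hm ↦ Eventually.of_forall fun n ↦ by omega
    · refine Eventually.of_forall fun m ↦ ?_
      obtain ⟨δ, hδ, h⟩ := huc m ε hε
      filter_upwards [hr2 δ hδ] with n hn
      simpa only [Function.iterate_add_apply] using h _ _ hn
    · filter_upwards [hq3 (ε / 2) (half_pos hε)] with m hm
      obtain ⟨δ, hδ, h⟩ := huc m (ε / 2) (half_pos hε)
      filter_upwards [hr3 δ hδ] with n hn
      rw [Function.iterate_add_apply]
      linarith [h _ _ hn, dist_triangle (T^[m] (T^[n] y)) (T^[m] y) y]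
  -- an ultrafilter witnessing proximality
  obtain ⟨V, hV1, hV2⟩ := exists_ultrafilter_of_frequently_lt
    fun ε hε N ↦ frequently_atTop.1 (hprox ε hε) N
  -- the limit of `T^n y` along `V` returns to `y`
  obtain ⟨y', -, hy'⟩ := isCompact_univ.ultrafilter_le_nhds (V.map fun n ↦ T^[n] y) (by simp)
  have hy'' : ∀ ε : ℝ, 0 < ε → ∀ᶠ n in (V : Filter ℕ), dist (T^[n] y) y' < ε := fun ε hε ↦
    hy' (Metric.ball_mem_nhds y' hε)
  have hret : ∀ ε : ℝ, 0 < ε → ∀ M : ℕ, ∃ n, M ≤ n ∧ dist (T^[n] y') y < ε := by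
    intro ε hε M
    obtain ⟨N, hN⟩ := hrec (Metric.ball y (ε / 2)) Metric.isOpen_ball
      (Metric.mem_ball_self (half_pos hε))
    have h1 : ∀ n ∈ Finset.range (M + N), ∀ᶠ m in V,
        dist (T^[n] (T^[m] y)) (T^[n] y') < ε / 2 := by
      intro n _
      obtain ⟨δ, hδ, h⟩ := huc n (ε / 2) (half_pos hε)
      filter_upwards [hy'' δ hδ] with m hm using h _ _ hm
    obtain ⟨m, hm⟩ := ((Filter.eventually_all_finset _).2 h1).exists
    obtain ⟨n, hn1, hn2, hn3⟩ := hN (m + M)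
    obtain ⟨i, rfl⟩ := Nat.exists_eq_add_of_le hn1
    refine ⟨M + i, by omega, ?_⟩
    have h2 := hm (M + i) (Finset.mem_range.2 (by omega))
    rw [← Function.iterate_add_apply, show M + i + m = m + M + i by ring, dist_comm] at h2
    have := Metric.mem_ball.1 hn3
    linarith [dist_triangle (T^[M + i] y') (T^[m + M + i] y) y]
  obtain ⟨W, hW1, hW2⟩ := exists_ultrafilter_of_frequently_lt hret
  have hne : L.Nonempty := by
    refine ⟨W + V, fun N ↦ ?_, fun ε hε ↦ ?_, fun ε hε ↦ ?_⟩ <;> rw [Ultrafilter.eventually_add]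
    · exact (hW1 N).mono fun m hm ↦ Eventually.of_forall fun n ↦ by omega
    · refine Eventually.of_forall fun m ↦ ?_
      obtain ⟨δ, hδ, h⟩ := huc m ε hε
      filter_upwards [hV2 δ hδ] with n hn
      simpa only [Function.iterate_add_apply] using h _ _ hn
    · filter_upwards [hW2 (ε / 2) (half_pos hε)] with m hm
      obtain ⟨δ, hδ, h⟩ := huc m (ε / 2) (half_pos hε)
      filter_upwards [hy'' δ hδ] with n hn
      rw [Function.iterate_add_apply]
      linarith [h _ _ hn, dist_triangle (T^[m] (T^[n] y)) (T^[m] y') y]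
  obtain ⟨p, ⟨hp1, hp2, hp3⟩, hp⟩ := exists_idempotent_in_compact_add_subsemigroup
    (fun r ↦ Ultrafilter.continuous_add_left r) L hne hLclosed.isCompact hLadd
  refine ⟨p, fun s hs ↦ ?_, fun P ↦ ?_, ?_⟩
  · obtain ⟨N, hN⟩ := mem_atTop_sets.1 hs
    exact mem_of_superset (hp1 N) hN
  · conv_lhs => rw [← hp]
    exact Ultrafilter.eventually_add p p P
  · obtain ⟨ε, hε, h⟩ := Metric.isOpen_iff.1 hU y hyU
    filter_upwards [hp2 (ε / 2) (half_pos hε), hp3 (ε / 2) (half_pos hε)] with n h1 h2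
    exact h (Metric.mem_ball.2 (by linarith [dist_triangle (T^[n] x) (T^[n] y) y]))

theorem exists_mem_FS_approx {ι : Type*} [Fintype ι] (a : ℕ → ℕ) (β : ι → ℝ) {δ : ℝ}
    (hδ : 0 < δ) : ∃ n ∈ FS a, ∃ u : ι → ℤ, ∀ i, |n * β i - u i| < δ := by
  let s : ℕ → ℕ := fun q ↦ ∑ i ∈ Finset.range q, a i
  let f : ℕ → ι → ℝ := fun q i ↦ Int.fract (s q * β i)
  obtain ⟨y, -, φ, hφ, hy⟩ := tendsto_subseq_of_bounded
    (Metric.isBounded_Icc (0 : ι → ℝ) 1) (x := f)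
    fun q ↦ ⟨fun i ↦ Int.fract_nonneg _, fun i ↦ (Int.fract_lt_one _).le⟩
  obtain ⟨N, hN⟩ := Metric.cauchySeq_iff.1 hy.cauchySeq δ hδ
  have hd := hN (N + 1) (by omega) N le_rfl
  have hlt : φ N < φ (N + 1) := hφ (by omega)
  refine ⟨∑ i ∈ Finset.Ico (φ N) (φ (N + 1)), a i, ⟨_, Finset.nonempty_Ico.2 hlt, rfl⟩,
    fun i ↦ ⌊s (φ (N + 1)) * β i⌋ - ⌊s (φ N) * β i⌋, fun i ↦ ?_⟩
  have h1 := (dist_le_pi_dist _ _ i).trans_lt hd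
  have h2 : s (φ N) + ∑ i ∈ Finset.Ico (φ N) (φ (N + 1)), a i = s (φ (N + 1)) :=
    Finset.sum_range_add_sum_Ico _ hlt.le
  have h3 : ((∑ i ∈ Finset.Ico (φ N) (φ (N + 1)), a i : ℕ) : ℝ) =
      s (φ (N + 1)) - s (φ N) := by
    rw [← h2]; push_cast; ring
  rw [Real.dist_eq] at h1
  simp only [f, Function.comp_apply, Int.fract] at h1
  rw [h3]
  push_cast
  have key : ∀ p q x y b : ℝ, (p - q) * b - (x - y) = p * b - x - (q * b - y) := by
    intros; ring
  rw [key]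
  exact h1

theorem exists_mem_FS_dvd_approx {ι : Type*} [Fintype ι] (a : ℕ → ℕ) (β : ι → ℝ) {δ : ℝ}
    (hδ : 0 < δ) {N : ℕ} (hN : 0 < N) :
    ∃ n ∈ FS a, N ∣ n ∧ ∃ u : ι → ℤ, ∀ i, |n * β i - u i| < δ := by
  have hN' : (0 : ℝ) < N := by exact_mod_cast hN
  obtain ⟨n, hn, u, hu⟩ := exists_mem_FS_approx a
    (fun i : Option ι ↦ i.elim (1 / N : ℝ) β) (lt_min hδ (one_div_pos.2 hN'))
  refine ⟨n, hn, ?_, fun i ↦ u (some i), fun i ↦ (hu (some i)).trans_le (min_le_left _ _)⟩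
  have h := (hu none).trans_le (min_le_right _ _)
  have h1 : |(n : ℝ) - u none * N| < 1 := by
    have : (n : ℝ) - u none * N = (n * (1 / N : ℝ) - u none) * N := by field_simp
    rw [this, abs_mul, abs_of_pos hN']
    calc _ < 1 / (N : ℝ) * N := by gcongr; exact h
      _ = 1 := by field_simp
  have h2 : |(n : ℤ) - u none * N| < 1 := by exact_mod_cast h1
  have h3 : (n : ℤ) = u none * N := by linear_combination Int.abs_lt_one_iff.1 h2
  exact Int.natCast_dvd_natCast.1 ⟨u none, h3.trans (mul_comm _ _)⟩

open MvPolynomial in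
theorem eval_smul_of_isHomogeneous {σ : Type*} {φ : MvPolynomial σ ℝ} {n : ℕ}
    (hφ : φ.IsHomogeneous n) (t : ℝ) (b : σ → ℝ) :
    eval (t • b) φ = t ^ n * eval b φ := by
  rw [eval_eq, eval_eq, Finset.mul_sum]
  refine Finset.sum_congr rfl fun m hm ↦ ?_
  have : m.degree = n := by
    rw [Finsupp.degree_eq_weight_one]; exact hφ (mem_support_iff.1 hm)
  simp only [Pi.smul_apply, smul_eq_mul, mul_pow, Finset.prod_mul_distrib,
    Finset.prod_pow_eq_pow_sum]
  rw [← this, Finsupp.degree_apply]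
  ring

open MvPolynomial in
/-- A polynomial evaluated at `c + b + A a`, expanded into monomials in `a` and homogeneous
polynomials in `b`. -/
theorem exists_eval_decomposition {e d : ℕ} (A : (Fin e → ℝ) →ₗ[ℝ] (Fin d → ℝ))
    (c : Fin d → ℝ) (g : MvPolynomial (Fin d) ℝ) :
    ∃ (T : Finset (ℕ × (Fin e →₀ ℕ))) (h : ℕ × (Fin e →₀ ℕ) → (Fin d → ℝ) → ℝ),
      (∀ i t b, h i (t • b) = t ^ i.1 * h i b) ∧
      ∀ b a, eval (c + b + A a) g = ∑ i ∈ T, h i b * eval a (monomial i.2 (1 : ℝ)) := by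
  let G : MvPolynomial (Fin e) (MvPolynomial (Fin d) ℝ) :=
    aeval (fun i ↦ C (C (c i)) + C (X i) + ∑ j, C (C (A (Pi.single j 1) i)) * X j) g
  let M := G.support.sup fun μ ↦ (coeff μ G).totalDegree
  refine ⟨Finset.range (M + 1) ×ˢ G.support,
    fun i b ↦ eval b (homogeneousComponent i.1 (coeff i.2 G)),
    fun i t b ↦ eval_smul_of_isHomogeneous (homogeneousComponent_isHomogeneous _ _) t b,
    fun b a ↦ ?_⟩
  have h1 : eval (c + b + A a) g = eval a (map (eval b) G) := by
    have hA : ∀ i, A a i = ∑ j, A (Pi.single j 1) i * a j := fun i ↦ by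
      conv_lhs => rw [← Finset.univ_sum_single a]
      rw [map_sum, Finset.sum_apply]
      refine Finset.sum_congr rfl fun j _ ↦ ?_
      rw [mul_comm, ← smul_eq_mul, ← Pi.smul_apply, ← map_smul, ← Pi.single_smul, smul_eq_mul,
        mul_one]
    have : ((eval a).comp (map (eval b))).comp (aeval (fun i ↦ C (C (c i)) + C (X i) +
        ∑ j, C (C (A (Pi.single j 1) i)) * X j) : MvPolynomial (Fin d) ℝ →ₐ[ℝ] _).toRingHom =
        eval (c + b + A a) :=
      ringHom_ext (fun r ↦ by simp [algebraMap_eq]) (fun i ↦ by simp [hA])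
    exact (RingHom.congr_fun this g).symm
  rw [h1, Finset.sum_product_right, eval_map, eval₂_eq]
  refine Finset.sum_congr rfl fun μ hμ ↦ ?_
  simp only
  rw [← Finset.sum_mul, ← map_sum]
  congr 1
  · conv_lhs => rw [← sum_homogeneousComponent (coeff μ G)]
    congr 1
    refine Finset.sum_subset (Finset.range_mono (Nat.succ_le_succ ?_)) fun n _ hn ↦ ?_
    · exact Finset.le_sup (f := fun μ ↦ (coeff μ G).totalDegree) hμ
    · exact homogeneousComponent_eq_zero _ _ (by simpa using hn)
  · simp [eval_monomial, Finsupp.prod]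

section DegreeFiltration

open MvPolynomial

/-- The polynomials of total degree less than `n`. -/
noncomputable def polyDegreeLT (σ : Type*) (n : ℕ) : Submodule ℝ (MvPolynomial σ ℝ) :=
  restrictSupport ℝ {μ | μ.degree < n}

theorem mem_polyDegreeLT {σ : Type*} {n : ℕ} {P : MvPolynomial σ ℝ} :
    P ∈ polyDegreeLT σ n ↔ ∀ μ ∈ P.support, μ.degree < n :=
  mem_restrictSupport_iff ℝ

theorem polyDegreeLT_mono {σ : Type*} {m n : ℕ} (h : m ≤ n) :
    polyDegreeLT σ m ≤ polyDegreeLT σ n :=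
  restrictSupport_mono ℝ fun _ hμ ↦ lt_of_lt_of_le hμ h

theorem mul_mem_polyDegreeLT {σ : Type*} {m n : ℕ} {P Q : MvPolynomial σ ℝ}
    (hP : P ∈ polyDegreeLT σ m) (hQ : Q ∈ polyDegreeLT σ (n + 1)) :
    P * Q ∈ polyDegreeLT σ (m + n) := by
  classical
  rw [mem_polyDegreeLT] at *
  intro μ hμ
  obtain ⟨μ₁, h₁, μ₂, h₂, rfl⟩ := Finset.mem_add.1 (support_mul P Q hμ)
  rw [map_add]
  have := hP _ h₁
  have := hQ _ h₂
  omega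

theorem monomial_mem_polyDegreeLT {σ : Type*} (μ : σ →₀ ℕ) (r : ℝ) {n : ℕ}
    (hμ : μ.degree < n) : monomial μ r ∈ polyDegreeLT σ n :=
  (monomial_mem_restrictSupport ℝ).2 (Or.inl hμ)

/-- Substitution of a homothety into a polynomial. -/
noncomputable def substHomothety {σ : Type*} (κ : ℝ) (τ : σ → ℝ) :
    MvPolynomial σ ℝ →ₐ[ℝ] MvPolynomial σ ℝ :=
  aeval fun i ↦ C κ * X i + C (τ i)

theorem eval_substHomothety {σ : Type*} (κ : ℝ) (τ x : σ → ℝ) (P : MvPolynomial σ ℝ) :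
    eval x (substHomothety κ τ P) = eval (κ • x + τ) P := by
  have : (eval x).comp (substHomothety κ τ).toRingHom = eval (κ • x + τ) :=
    ringHom_ext (fun r ↦ by simp [substHomothety, algebraMap_eq])
      (fun i ↦ by simp [substHomothety])
  exact RingHom.congr_fun this P

theorem substHomothety_monomial_sub_mem {σ : Type*} (κ : ℝ) (τ : σ → ℝ) (μ : σ →₀ ℕ) :
    substHomothety κ τ (monomial μ 1) - C (κ ^ μ.degree) * monomial μ 1 ∈
      polyDegreeLT σ μ.degree := by
  have hadd : ∀ μ ν : σ →₀ ℕ,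
      substHomothety κ τ (monomial μ 1) - C (κ ^ μ.degree) * monomial μ 1 ∈
        polyDegreeLT σ μ.degree →
      substHomothety κ τ (monomial ν 1) - C (κ ^ ν.degree) * monomial ν 1 ∈
        polyDegreeLT σ ν.degree →
      substHomothety κ τ (monomial (μ + ν) 1) - C (κ ^ (μ + ν).degree) * monomial (μ + ν) 1 ∈
        polyDegreeLT σ (μ + ν).degree := by
    intro μ ν hμ hν
    have hmem : ∀ ν : σ →₀ ℕ, C (κ ^ ν.degree) * monomial ν 1 ∈ polyDegreeLT σ (ν.degree + 1) :=
      fun ν ↦ by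
        rw [C_mul_monomial]
        exact monomial_mem_polyDegreeLT _ _ (Nat.lt_succ_self _)
    have h2 : substHomothety κ τ (monomial ν 1) ∈ polyDegreeLT σ (ν.degree + 1) := by
      have := add_mem (polyDegreeLT_mono (Nat.le_succ _) hν) (hmem ν)
      rwa [sub_add_cancel] at this
    have h3 : (monomial (μ + ν) 1 : MvPolynomial σ ℝ) = monomial μ 1 * monomial ν 1 := by
      rw [monomial_mul, one_mul]
    have := add_mem (mul_mem_polyDegreeLT hμ h2)
      (add_comm ν.degree μ.degree ▸ mul_mem_polyDegreeLT hν (hmem μ))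
    rw [map_add, h3, map_mul, pow_add, C_mul]
    convert this using 1
    ring
  induction μ using Finsupp.induction_linear with
  | zero => simp
  | add μ ν hμ hν => exact hadd μ ν hμ hν
  | single i k =>
    induction k with
    | zero => simp
    | succ k ih =>
      rw [Finsupp.single_add]
      refine hadd _ _ ih ?_
      have : substHomothety κ τ (monomial (Finsupp.single i 1) 1) -
          C (κ ^ (Finsupp.single i 1).degree) * monomial (Finsupp.single i 1) 1 =
          monomial 0 (τ i) := by
        rw [Finsupp.degree_single, pow_one, ← X, substHomothety, aeval_X, ← C_apply]
        ring
      rw [this]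
      exact monomial_mem_polyDegreeLT _ _ (by simp)

theorem substHomothety_sub_mem {σ : Type*} (κ : ℝ) (τ : σ → ℝ) {D : ℕ} {P : MvPolynomial σ ℝ}
    (hP : P ∈ polyDegreeLT σ (D + 1)) :
    substHomothety κ τ P - C (κ ^ D) * P ∈ polyDegreeLT σ D := by
  rw [mem_polyDegreeLT] at hP
  rw [P.as_sum, map_sum, Finset.mul_sum, ← Finset.sum_sub_distrib]
  refine sum_mem fun μ hμ ↦ ?_
  have h1 : (monomial μ (coeff μ P) : MvPolynomial σ ℝ) = coeff μ P • monomial μ 1 := by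
    rw [smul_monomial, smul_eq_mul, mul_one]
  rw [h1, map_smul, mul_smul_comm, ← smul_sub]
  refine Submodule.smul_mem _ _ ?_
  rcases (Nat.lt_succ_iff.1 (hP μ hμ)).lt_or_eq with h | h
  · have h2 := add_mem (polyDegreeLT_mono h.le (substHomothety_monomial_sub_mem κ τ μ))
      (monomial_mem_polyDegreeLT μ (κ ^ μ.degree) h)
    rw [C_mul_monomial, mul_one, sub_add_cancel] at h2
    refine sub_mem h2 ?_
    rw [C_mul_monomial]
    exact monomial_mem_polyDegreeLT _ _ h
  · rw [← h]
    exact substHomothety_monomial_sub_mem κ τ μ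

theorem eval_homogeneous_of_homothety {σ : Type*} {κ : ℝ} (hκ : 1 < κ) {γ : σ → ℝ} {D : ℕ}
    {P : MvPolynomial σ ℝ} (h : ∀ x, eval (κ • x + (1 - κ) • γ) P = κ ^ D * eval x P)
    (s : ℝ) (w : σ → ℝ) : eval (γ + s • w) P = s ^ D * eval (γ + w) P := by
  let q : Polynomial ℝ := aeval (fun i ↦ Polynomial.C (γ i) + Polynomial.C (w i) * Polynomial.X) P
  have hq : ∀ s, q.eval s = eval (γ + s • w) P := fun s ↦ by
    have : (Polynomial.evalRingHom s).comp (aeval (fun i ↦ Polynomial.C (γ i) +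
        Polynomial.C (w i) * Polynomial.X) : MvPolynomial σ ℝ →ₐ[ℝ] _).toRingHom =
        eval (γ + s • w) :=
      ringHom_ext (fun r ↦ by simp) (fun i ↦ by simp; ring)
    exact RingHom.congr_fun this P
  have hcomp : q.comp (Polynomial.C κ * Polynomial.X) = Polynomial.C (κ ^ D) * q := by
    refine Polynomial.funext fun s ↦ ?_
    simp only [Polynomial.eval_comp, Polynomial.eval_mul, Polynomial.eval_C, Polynomial.eval_X, hq]
    have hv : γ + (κ * s) • w = κ • (γ + s • w) + (1 - κ) • γ := by module
    rw [← h, ← hv]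
  have hcoeff : ∀ n, n ≠ D → q.coeff n = 0 := fun n hn ↦ by
    have h1 := congrArg (Polynomial.coeff · n) hcomp
    simp only [Polynomial.comp_C_mul_X_coeff, Polynomial.coeff_C_mul] at h1
    have h2 : κ ^ n - κ ^ D ≠ 0 := sub_ne_zero.2 fun h ↦
      hn (pow_right_injective₀ (by linarith) hκ.ne' h)
    exact (mul_eq_zero.1 (by linarith : (κ ^ n - κ ^ D) * q.coeff n = 0)).resolve_left h2
  have hmon : q = Polynomial.monomial D (q.coeff D) := by
    ext n
    rw [Polynomial.coeff_monomial]
    split_ifs with hn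
    · rw [hn]
    · exact hcoeff n (Ne.symm hn)
  have h1 := hq 1
  rw [one_smul] at h1
  rw [← hq, ← h1, hmon]
  simp [mul_comm]

theorem eval_add_eq_of_homogeneous {σ : Type*} [Finite σ] {γ γ' : σ → ℝ} {D : ℕ}
    {P : MvPolynomial σ ℝ}
    (h : ∀ (s : ℝ) w, eval (γ + s • w) P = s ^ D * eval (γ + w) P)
    (h' : ∀ (s : ℝ) w, eval (γ' + s • w) P = s ^ D * eval (γ' + w) P)
    (x : σ → ℝ) (s : ℝ) : eval (x + s • (γ' - γ)) P = eval x P := by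
  have hlim : ∀ w, eval (γ' + w) P = eval (γ + w) P := by
    intro w
    have hc : Continuous fun t : ℝ ↦ eval (γ' + (w + t • (γ - γ'))) P :=
      (MvPolynomial.continuous_eval P).comp (by fun_prop)
    have ht : Tendsto (fun n : ℕ ↦ eval (γ' + (w + (1 / ((n : ℝ) + 1)) • (γ - γ'))) P) atTop
        (𝓝 (eval (γ' + (w + (0 : ℝ) • (γ - γ'))) P)) :=
      (hc.tendsto 0).comp tendsto_one_div_add_atTop_nhds_zero_nat
    rw [zero_smul, add_zero] at ht
    refine tendsto_nhds_unique ht (tendsto_const_nhds.congr fun n ↦ ?_)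
    have hn : ((n : ℝ) + 1) ≠ 0 := by positivity
    have e1 := h (n + 1) w
    have e2 := h' (n + 1) (w + (1 / ((n : ℝ) + 1)) • (γ - γ'))
    have e3 : γ' + ((n : ℝ) + 1) • (w + (1 / ((n : ℝ) + 1)) • (γ - γ')) =
        γ + ((n : ℝ) + 1) • w := by
      rw [smul_add, smul_smul, mul_one_div_cancel hn]
      module
    rw [e3, e1] at e2
    exact mul_left_cancel₀ (pow_ne_zero D hn) e2
  rcases eq_or_ne s 0 with rfl | hs
  · simp
  have e1 := h s (s⁻¹ • (x - γ) + (γ' - γ))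
  have e2 := h s (s⁻¹ • (x - γ))
  have e3 : γ + s • (s⁻¹ • (x - γ) + (γ' - γ)) = x + s • (γ' - γ) := by
    rw [smul_add, smul_smul, mul_inv_cancel₀ hs]
    module
  have e4 : γ + (s⁻¹ • (x - γ) + (γ' - γ)) = γ' + s⁻¹ • (x - γ) := by module
  have e5 : γ + s • s⁻¹ • (x - γ) = x := by
    rw [smul_smul, mul_inv_cancel₀ hs]
    module
  rw [e3, e4, hlim] at e1
  rw [e5] at e2
  rw [e1, e2]

theorem eq_zero_of_eventually_eval_eq_zero {p : Ultrafilter ℕ} (hp : IsAddIdem p) {e : ℕ}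
    {κ : ℕ → ℝ} {γ β : ℕ → Fin e → ℝ} (hκ : ∀ᶠ r in p, 1 < κ r)
    (hβ : ∀ᶠ r in p, ∀ᶠ j in p, β (r + j) = κ r • β j + (1 - κ r) • γ r)
    (hspan : ∀ B : Set ℕ, (∀ᶠ r in p, r ∈ B) →
      Submodule.span ℝ {w | ∃ r ∈ B, ∃ s ∈ B, w = γ r - γ s} = ⊤)
    {P : MvPolynomial (Fin e) ℝ} (hP : ∀ᶠ j in p, eval (β j) P = 0) : P = 0 := by
  suffices H : ∀ n, ∀ P ∈ polyDegreeLT (Fin e) n, (∀ᶠ j in p, eval (β j) P = 0) → P = 0 by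
    refine H (P.support.sup Finsupp.degree + 1) P (mem_polyDegreeLT.2 fun μ hμ ↦ ?_) hP
    exact Nat.lt_succ_of_le (Finset.le_sup (f := Finsupp.degree) hμ)
  clear hP P
  intro n
  induction n with
  | zero =>
    intro P hP _
    rw [mem_polyDegreeLT] at hP
    exact support_eq_empty.1 (Finset.eq_empty_of_forall_notMem fun μ hμ ↦ absurd (hP μ hμ) (by simp))
  | succ D ih =>
    intro P hP hP0
    have hhom : ∀ᶠ r in p, ∀ (s : ℝ) w, eval (γ r + s • w) P = s ^ D * eval (γ r + w) P := by
      filter_upwards [hκ, hβ, (hp _).1 hP0] with r hr hβr hPr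
      refine eval_homogeneous_of_homothety hr fun x ↦ ?_
      have h0 := ih _ (substHomothety_sub_mem (κ r) ((1 - κ r) • γ r) hP) (by
        filter_upwards [hβr, hPr, hP0] with j h1 h2 h3
        rw [map_sub, eval_substHomothety, ← h1, h2, map_mul, h3, mul_zero, sub_zero])
      have := congrArg (eval x) h0
      rw [map_sub, eval_substHomothety, map_mul, eval_C, map_zero] at this
      linarith
    have hinv : ∀ w x, ∀ s : ℝ, eval (x + s • w) P = eval x P := by
      intro w
      have hw : w ∈ Submodule.span ℝ {w | ∃ r ∈ {r | ∀ (s : ℝ) w, eval (γ r + s • w) P =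
          s ^ D * eval (γ r + w) P}, ∃ s ∈ {r | ∀ (s : ℝ) w, eval (γ r + s • w) P =
          s ^ D * eval (γ r + w) P}, w = γ r - γ s} := by
        rw [hspan {r | ∀ (s : ℝ) w, eval (γ r + s • w) P = s ^ D * eval (γ r + w) P} hhom]
        trivial
      induction hw using Submodule.span_induction with
      | mem w hw =>
        obtain ⟨r, hr, s, hs, rfl⟩ := hw
        exact fun x t ↦ eval_add_eq_of_homogeneous hs hr x t
      | zero => simp
      | add u v _ _ hu hv => intro x s; rw [smul_add, ← add_assoc, hv, hu]
      | smul a u _ hu => intro x s; rw [smul_smul, hu]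
    obtain ⟨j, hj⟩ := hP0.exists
    refine MvPolynomial.funext fun x ↦ ?_
    have := hinv (x - β j) (β j) 1
    rw [one_smul, add_sub_cancel, hj] at this
    rw [this, map_zero]

end DegreeFiltration

section Signs

theorem exists_tendsto_of_eventually_abs_le {p : Ultrafilter ℕ} {ι : Type*} [Fintype ι]
    {f : ℕ → ι → ℝ} {R : ℝ} (h : ∀ᶠ m in (p : Filter ℕ), ∀ i, |f m i| ≤ R) :
    ∃ y, Tendsto f p (𝓝 y) := by
  obtain ⟨y, -, hy⟩ := (isCompact_Icc (a := fun _ : ι ↦ -R) (b := fun _ ↦ R)).ultrafilter_le_nhds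
    (p.map f) (tendsto_principal.2 (h.mono fun m hm ↦
      ⟨fun i ↦ (abs_le.1 (hm i)).1, fun i ↦ (abs_le.1 (hm i)).2⟩))
  exact ⟨y, hy⟩

theorem eq_zero_of_tendsto_of_eventually_mul {p : Ultrafilter ℕ} (hp : IsAddIdem p)
    {ρ c : ℕ → ℝ} {y : ℝ} (hρ : Tendsto ρ p (𝓝 y))
    (h : ∀ᶠ r in (p : Filter ℕ), ∀ᶠ m in (p : Filter ℕ), ρ (r + m) = c r * ρ m)
    (hc : ∀ᶠ r in (p : Filter ℕ), 1 / 2 ≤ |c r - 1|) : y = 0 := by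
  by_contra hy
  have h1 : ∀ᶠ m in (p : Filter ℕ), |ρ m - y| < |y| / 4 :=
    Metric.tendsto_nhds.1 hρ (|y| / 4) (by positivity)
  obtain ⟨r, h1, h2, h3⟩ := (((hp _).1 h1).and (h.and hc)).exists
  have h4 : |c r * y - y| ≤ |y| / 4 := by
    refine le_of_tendsto ((hρ.const_mul (c r)).sub_const y).abs ?_
    filter_upwards [h1, h2] with m hm hm'
    rw [← hm']
    exact hm.le
  rw [← sub_one_mul, abs_mul] at h4
  have : 0 < |y| := abs_pos.2 hy
  nlinarith

theorem half_le_abs_pow_div_pow_sub_one {κ : ℝ} (hκ : 2 ≤ κ) {m n : ℕ} (h : m ≠ n) :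
    1 / 2 ≤ |κ ^ m / κ ^ n - 1| := by
  have h0 : (0 : ℝ) < κ := by linarith
  rcases lt_or_gt_of_ne h with h | h
  · obtain ⟨j, rfl⟩ := Nat.exists_eq_add_of_lt h
    have h1 : κ ^ m / κ ^ (m + j + 1) = 1 / κ ^ (j + 1) := by
      rw [add_assoc, pow_add]
      field_simp
    have h2 : 2 ≤ κ ^ (j + 1) := hκ.trans (le_self_pow₀ (by linarith) (by omega))
    rw [h1, abs_sub_comm]
    refine le_trans ?_ (le_abs_self _)
    have : 1 / κ ^ (j + 1) ≤ 1 / 2 := one_div_le_one_div_of_le two_pos h2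
    linarith
  · obtain ⟨j, rfl⟩ := Nat.exists_eq_add_of_lt h
    have h1 : κ ^ (n + j + 1) / κ ^ n = κ ^ (j + 1) := by
      rw [add_assoc, pow_add]
      field_simp
    have h2 : 2 ≤ κ ^ (j + 1) := hκ.trans (le_self_pow₀ (by linarith) (by omega))
    rw [h1]
    refine le_trans ?_ (le_abs_self _)
    linarith

theorem exists_dominant {p : Ultrafilter ℕ} (hp : IsAddIdem p) {ι : Type*} {T : Finset ι}
    {η : ι → ℕ → ℝ} {w : ι → ℕ} {κ : ℕ → ℝ} (hκ : ∀ᶠ r in (p : Filter ℕ), 2 ≤ κ r)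
    (hη : ∀ᶠ r in (p : Filter ℕ), ∀ᶠ m in (p : Filter ℕ),
      ∀ i, η i (r + m) = κ r ^ w i * η i m)
    (h0 : ¬ ∀ᶠ m in (p : Filter ℕ), ∀ i ∈ T, η i m = 0) :
    ∃ i₀ ∈ T, (∀ᶠ m in (p : Filter ℕ), η i₀ m ≠ 0) ∧ ∃ y : ι → ℝ, y i₀ = 1 ∧ ∀ i ∈ T,
      Tendsto (fun m ↦ η i m / η i₀ m) p (𝓝 (y i)) ∧ (w i ≠ w i₀ → y i = 0) := by
  have hT : T.Nonempty := by
    rw [Finset.nonempty_iff_ne_empty]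
    rintro rfl
    simp at h0
  obtain ⟨i₀, hi₀, hmax⟩ := (Ultrafilter.eventually_exists_mem_iff (f := p)
    (P := fun i m ↦ ∀ j ∈ T, |η j m| ≤ |η i m|) T.finite_toSet).1
    (Eventually.of_forall fun m ↦ T.exists_max_image (fun i ↦ |η i m|) hT)
  have hne : ∀ᶠ m in (p : Filter ℕ), η i₀ m ≠ 0 := by
    filter_upwards [hmax, Ultrafilter.eventually_not.2 h0] with m hm hm0 h
    refine hm0 fun i hi ↦ ?_
    have := hm i hi
    rw [h, abs_zero] at this
    exact abs_nonpos_iff.1 this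
  have hlim : ∀ i ∈ T, ∃ y, Tendsto (fun m ↦ η i m / η i₀ m) p (𝓝 y) := by
    intro i hi
    obtain ⟨y, hy⟩ := exists_tendsto_of_eventually_abs_le (p := p) (ι := Unit)
      (f := fun m _ ↦ η i m / η i₀ m) (R := 1) (by
        filter_upwards [hmax, hne] with m hm hm0 _
        rw [abs_div]
        exact (div_le_one (abs_pos.2 hm0)).2 (hm i hi))
    exact ⟨y (), (tendsto_pi_nhds.1 hy) ()⟩
  choose! y hy using hlim
  have hy1 : y i₀ = 1 := tendsto_nhds_unique (hy i₀ hi₀)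
    (tendsto_const_nhds.congr' (by filter_upwards [hne] with m hm using (div_self hm).symm))
  refine ⟨i₀, hi₀, hne, y, hy1, fun i hi ↦ ⟨hy i hi, fun hw ↦ ?_⟩⟩
  refine eq_zero_of_tendsto_of_eventually_mul hp (hy i hi) (c := fun r ↦ κ r ^ w i / κ r ^ w i₀)
    ?_ (hκ.mono fun r hr ↦ half_le_abs_pow_div_pow_sub_one hr hw)
  filter_upwards [hη] with r hr
  filter_upwards [hr] with m hm
  rw [hm, hm, mul_div_mul_comm]

theorem exists_eventually_sign_eq {p : Ultrafilter ℕ} (hp : IsAddIdem p) {d e : ℕ} {κ : ℕ → ℝ}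
    (hκ : ∀ᶠ r in (p : Filter ℕ), 2 ≤ κ r) (A : (Fin e → ℝ) →ₗ[ℝ] (Fin d → ℝ)) (c : Fin d → ℝ)
    {b : ℕ → Fin d → ℝ}
    (hb : ∀ᶠ r in (p : Filter ℕ), ∀ᶠ m in (p : Filter ℕ), b (r + m) = κ r • b m)
    (g : MvPolynomial (Fin d) ℝ) :
    (∀ᶠ m in (p : Filter ℕ), ∀ (t : ℝ) a, MvPolynomial.eval (c + t • b m + A a) g = 0) ∨
    ∃ P : MvPolynomial (Fin e) ℝ, P ≠ 0 ∧ ∀ β, MvPolynomial.eval β P ≠ 0 →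
      ∃ δ > 0, ∃ s : SignType, ∀ t : ℝ, 0 < t → ∀ᶠ m in (p : Filter ℕ),
        ∀ a, dist a β ≤ δ → SignType.sign (MvPolynomial.eval (c + t • b m + A a) g) = s := by
  obtain ⟨T, h, hhom, hg⟩ := exists_eval_decomposition A c g
  by_cases h0 : ∀ᶠ m in (p : Filter ℕ), ∀ i ∈ T, h i (b m) = 0
  · left
    filter_upwards [h0] with m hm t a
    rw [hg]
    exact Finset.sum_eq_zero fun i hi ↦ by rw [hhom, hm i hi, mul_zero, zero_mul]
  right
  obtain ⟨i₀, hi₀, hne, y, hy1, hy⟩ := exists_dominant hp (η := fun i m ↦ h i (b m))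
    (w := Prod.fst) hκ (by
      filter_upwards [hb] with r hr
      filter_upwards [hr] with m hm i
      rw [hm, hhom]) h0
  obtain ⟨s₀, hs₀⟩ : ∃ s₀, ∀ᶠ m in (p : Filter ℕ), SignType.sign (h i₀ (b m)) = s₀ := by
    obtain ⟨s₀, -, hs₀⟩ := (Ultrafilter.eventually_exists_mem_iff (f := p)
      (P := fun s m ↦ SignType.sign (h i₀ (b m)) = s) Set.finite_univ).1
      (Eventually.of_forall fun m ↦ ⟨_, trivial, rfl⟩)
    exact ⟨s₀, hs₀⟩
  let P : MvPolynomial (Fin e) ℝ := ∑ i ∈ T, y i • MvPolynomial.monomial i.2 1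
  have hP : ∀ a, MvPolynomial.eval a P =
      ∑ i ∈ T, y i * MvPolynomial.eval a (MvPolynomial.monomial i.2 (1 : ℝ)) := fun a ↦ by
    simp only [P, map_sum, MvPolynomial.smul_eval]
  refine ⟨P, fun hP0 ↦ ?_, fun β hβ ↦ ?_⟩
  · have h1 : MvPolynomial.coeff i₀.2 P = 1 := by
      simp only [P, MvPolynomial.coeff_sum, MvPolynomial.coeff_smul, MvPolynomial.coeff_monomial]
      rw [Finset.sum_eq_single i₀]
      · simp [hy1]
      · intro i hi hne
        split_ifs with h2
        · rw [(hy i hi).2 fun h1 ↦ hne (Prod.ext h1 h2), zero_smul]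
        · simp
      · exact fun h ↦ absurd hi₀ h
    rw [hP0, MvPolynomial.coeff_zero] at h1
    exact zero_ne_one h1
  have hsign : ∀ x : ℝ, x ≠ 0 → ∀ᶠ x' in 𝓝 x, SignType.sign x' = SignType.sign x := fun x hx ↦
    (continuousAt_sign_of_ne_zero hx).eventually (p := (· = SignType.sign x)) (by simp)
  obtain ⟨δ, hδ, hball⟩ := Metric.nhds_basis_closedBall.eventually_iff.1
    ((MvPolynomial.continuous_eval P).continuousAt.eventually (hsign _ hβ))
  refine ⟨δ, hδ, s₀ * SignType.sign (MvPolynomial.eval β P), fun t ht ↦ ?_⟩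
  let F : ℕ × (Fin e → ℝ) → ℝ := fun q ↦ ∑ i ∈ T, t ^ i.1 / t ^ i₀.1 *
    (h i (b q.1) / h i₀ (b q.1)) * MvPolynomial.eval q.2 (MvPolynomial.monomial i.2 (1 : ℝ))
  have hF : ∀ a₀, Tendsto F ((p : Filter ℕ) ×ˢ 𝓝 a₀) (𝓝 (MvPolynomial.eval a₀ P)) := by
    intro a₀
    rw [hP]
    refine tendsto_finsetSum _ fun i hi ↦ ?_
    have h1 : y i = t ^ i.1 / t ^ i₀.1 * y i := by
      by_cases hw : i.1 = i₀.1
      · rw [hw, div_self (pow_pos ht _).ne', one_mul]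
      · rw [(hy i hi).2 hw, mul_zero]
    rw [h1]
    exact (((hy i hi).1.comp tendsto_fst).const_mul _).mul
      (((MvPolynomial.continuous_eval _).tendsto a₀).comp tendsto_snd)
  have hK := (isCompact_closedBall β δ).mem_prod_nhdsSet_of_forall (l := (p : Filter ℕ))
    (s := {q | SignType.sign (F q) = SignType.sign (MvPolynomial.eval β P)}) fun a₀ ha₀ ↦ by
      have h1 := hball ha₀
      have h2 : MvPolynomial.eval a₀ P ≠ 0 := by rwa [← sign_ne_zero, h1, sign_ne_zero]
      exact (hF a₀).eventually (h1 ▸ hsign _ h2)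
  filter_upwards [Eventually.curry hK, hs₀, hne] with m hm hs hm0 a ha
  have h1 := hm.self_of_nhdsSet a (Metric.mem_closedBall.2 ha)
  have h2 : MvPolynomial.eval (c + t • b m + A a) g = t ^ i₀.1 * h i₀ (b m) * F (m, a) := by
    rw [hg, Finset.mul_sum]
    refine Finset.sum_congr rfl fun i _ ↦ ?_
    have := (pow_pos ht i₀.1).ne'
    rw [hhom]
    field_simp
  change SignType.sign (F (m, a)) = _ at h1
  rw [h2, sign_mul, sign_mul, h1, hs, sign_pos (pow_pos ht _), one_mul]

end Signs

theorem exists_minimal_submodule {p : Ultrafilter ℕ} {E : Type*} [AddCommGroup E] [Module ℝ E]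
    [FiniteDimensional ℝ E] (c : ℕ → E) :
    ∃ (U : Submodule ℝ E) (c₀ : E), (∀ᶠ r in (p : Filter ℕ), c r - c₀ ∈ U) ∧
      ∀ B : Set ℕ, (∀ᶠ r in (p : Filter ℕ), r ∈ B) →
        U ≤ Submodule.span ℝ {w | ∃ r ∈ B, ∃ s ∈ B, w = c r - c s} := by
  obtain ⟨U, ⟨c₀, hU⟩, hmin⟩ := (wellFounded_lt (α := Submodule ℝ E)).has_min
    {U | ∃ c₀, ∀ᶠ r in (p : Filter ℕ), c r - c₀ ∈ U} ⟨⊤, 0, by simp⟩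
  refine ⟨U, c₀, hU, fun B hB ↦ ?_⟩
  by_contra hUB
  refine hmin (U ⊓ Submodule.span ℝ {w | ∃ r ∈ B, ∃ s ∈ B, w = c r - c s}) ?_
    (inf_lt_left.2 hUB)
  obtain ⟨s, hsU, hsB⟩ := (hU.and hB).exists
  refine ⟨c s, ?_⟩
  filter_upwards [hU, hB] with r hrU hrB
  refine ⟨?_, Submodule.subset_span ⟨r, hrB, s, hsB, rfl⟩⟩
  simpa using sub_mem hrU hsU

theorem exists_integral_parametrization {p : Ultrafilter ℕ} {d : ℕ} {c : ℕ → Fin d → ℝ}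
    (hc : ∀ᶠ r in (p : Filter ℕ), ∃ N : ℕ, 0 < N ∧ ∃ v : Fin d → ℤ, ∀ i, N * c r i = v i) :
    ∃ (e : ℕ) (A : (Fin e → ℝ) →ₗ[ℝ] (Fin d → ℝ)) (Q : (Fin d → ℝ) →ₗ[ℝ] (Fin e → ℝ))
      (c₀ : Fin d → ℝ) (N : ℕ), 0 < N ∧ (∃ v : Fin d → ℤ, ∀ i, N * c₀ i = v i) ∧
      (∀ x, Q (A x) = x) ∧
      (∀ u : Fin e → ℤ, ∃ v : Fin d → ℤ, ∀ i, A (fun j ↦ (u j : ℝ)) i = v i) ∧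
      (∀ᶠ r in (p : Filter ℕ), A (Q (c r - c₀)) = c r - c₀) ∧
      ∀ B : Set ℕ, (∀ᶠ r in (p : Filter ℕ), r ∈ B) →
        Submodule.span ℝ {w | ∃ r ∈ B, ∃ s ∈ B, w = Q (c r - c₀) - Q (c s - c₀)} = ⊤ := by
  obtain ⟨U, c₁, hU, hspan⟩ := exists_minimal_submodule (p := p) c
  let S : Set (Fin d → ℝ) := {w | w ∈ U ∧ ∃ v : Fin d → ℤ, ∀ i, w i = v i}
  have hS : Submodule.span ℝ S = U := by
    refine le_antisymm (Submodule.span_le.2 fun w hw ↦ hw.1) ?_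
    refine (hspan _ (hU.and hc)).trans (Submodule.span_le.2 ?_)
    rintro _ ⟨r, ⟨hrU, N, hN, v, hv⟩, s, ⟨hsU, N', hN', v', hv'⟩, rfl⟩
    have hne : (N : ℝ) * N' ≠ 0 := by positivity
    rw [SetLike.mem_coe, ← Submodule.smul_mem_iff _ hne]
    refine Submodule.subset_span ⟨U.smul_mem _ ?_, fun i ↦ N' * v i - N * v' i, fun i ↦ ?_⟩
    · simpa using sub_mem hrU hsU
    · push_cast
      rw [← hv, ← hv', Pi.smul_apply, Pi.sub_apply, smul_eq_mul]
      ring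
  obtain ⟨f, hfS, hfspan, hf⟩ := Submodule.exists_fun_fin_finrank_span_eq ℝ S
  have hA : LinearMap.ker (Fintype.linearCombination ℝ f) = ⊥ :=
    LinearMap.ker_eq_bot.2 (linearIndependent_iff_injective_fintypeLinearCombination.1 hf)
  obtain ⟨Q, hQ⟩ := LinearMap.exists_leftInverse_of_injective _ hA
  have hQ' : ∀ x, Q (Fintype.linearCombination ℝ f x) = x := LinearMap.congr_fun hQ
  have hrange : LinearMap.range (Fintype.linearCombination ℝ f) = U := by
    rw [Fintype.range_linearCombination, hfspan, hS]
  have hAQ : ∀ u ∈ U, Fintype.linearCombination ℝ f (Q u) = u := by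
    intro u hu
    rw [← hrange] at hu
    obtain ⟨x, rfl⟩ := hu
    rw [hQ']
  obtain ⟨r₀, hr₀, N, hN, hNv⟩ := (hU.and hc).exists
  have hgood : ∀ᶠ r in (p : Filter ℕ), c r - c r₀ ∈ U := by
    filter_upwards [hU] with r hr
    simpa using sub_mem hr hr₀
  refine ⟨_, Fintype.linearCombination ℝ f, Q, c r₀, N, hN, hNv, hQ', fun u ↦ ?_,
    hgood.mono fun r hr ↦ hAQ _ hr, fun B hB ↦ eq_top_iff.2 fun x _ ↦ ?_⟩
  · choose v hv using fun j ↦ (hfS j).2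
    refine ⟨fun i ↦ ∑ j, u j * v j i, fun i ↦ ?_⟩
    simp [Fintype.linearCombination_apply, hv]
  · have h1 : Submodule.span ℝ {w | ∃ r ∈ {r | r ∈ B ∧ c r - c r₀ ∈ U},
        ∃ s ∈ {r | r ∈ B ∧ c r - c r₀ ∈ U}, w = c r - c s} ≤
        (Submodule.span ℝ {w | ∃ r ∈ B, ∃ s ∈ B, w = Q (c r - c r₀) - Q (c s - c r₀)}).map
          (Fintype.linearCombination ℝ f) := by
      refine Submodule.span_le.2 ?_
      rintro _ ⟨r, hr, s, hs, rfl⟩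
      refine ⟨_, Submodule.subset_span ⟨r, hr.1, s, hs.1, rfl⟩, ?_⟩
      rw [map_sub, hAQ _ hr.2, hAQ _ hs.2, sub_sub_sub_cancel_right]
    obtain ⟨y, hy, hyx⟩ := h1 (hspan _ (hB.and hgood) (hrange ▸ LinearMap.mem_range_self _ x))
    rw [← hQ' x, ← hyx, hQ']
    exact hy

section Renormalization

theorem exists_eventually_fract_pow_add_mul (p : Ultrafilter ℕ) {d : ℕ} (k : ℕ) (x : Fin d → ℝ)
    (r : ℕ) : ∃ v : Fin d → ℤ, ∀ᶠ m in (p : Filter ℕ), ∀ i,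
      Int.fract ((k : ℝ) ^ (r + m) * x i) = (k : ℝ) ^ r * Int.fract ((k : ℝ) ^ m * x i) - v i := by
  obtain ⟨v, -, hv⟩ := (Ultrafilter.eventually_exists_mem_iff (f := p)
    (is := Set.Icc (fun _ : Fin d ↦ -(k : ℤ) ^ r - 1) fun _ ↦ (k : ℤ) ^ r)
    (P := fun v m ↦ ∀ i, Int.fract ((k : ℝ) ^ (r + m) * x i) =
      (k : ℝ) ^ r * Int.fract ((k : ℝ) ^ m * x i) - v i) (Set.finite_Icc _ _)).1
    (Eventually.of_forall fun m ↦ by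
      let v : Fin d → ℤ := fun i ↦ ⌊(k : ℝ) ^ (r + m) * x i⌋ - (k : ℤ) ^ r * ⌊(k : ℝ) ^ m * x i⌋
      have hv : ∀ i, Int.fract ((k : ℝ) ^ (r + m) * x i) =
          (k : ℝ) ^ r * Int.fract ((k : ℝ) ^ m * x i) - v i := fun i ↦ by
        simp only [Int.fract, v]
        push_cast
        ring
      have hk : (0 : ℝ) ≤ (k : ℝ) ^ r := by positivity
      refine ⟨v, ⟨fun i ↦ ?_, fun i ↦ ?_⟩, hv⟩
      · have h1 := Int.fract_lt_one ((k : ℝ) ^ (r + m) * x i)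
        have h2 := mul_nonneg hk (Int.fract_nonneg ((k : ℝ) ^ m * x i))
        have h3 : ((-(k : ℤ) ^ r - 1 : ℤ) : ℝ) ≤ v i := by
          push_cast
          linarith [hv i]
        exact_mod_cast h3
      · have h1 := Int.fract_nonneg ((k : ℝ) ^ (r + m) * x i)
        have h2 := mul_le_of_le_one_right hk (Int.fract_lt_one ((k : ℝ) ^ m * x i)).le
        have h3 : (v i : ℝ) ≤ ((k : ℤ) ^ r : ℤ) := by
          push_cast
          linarith [hv i]
        exact_mod_cast h3)
  exact ⟨v, hv⟩

theorem exists_renormalization {p : Ultrafilter ℕ} (hp : (p : Filter ℕ) ≤ atTop) {d k : ℕ}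
    (hk : 2 ≤ k) (x : Fin d → ℝ) :
    ∃ (e : ℕ) (A : (Fin e → ℝ) →ₗ[ℝ] (Fin d → ℝ)) (c : Fin d → ℝ) (N : ℕ)
      (a γ : ℕ → Fin e → ℝ) (b : ℕ → Fin d → ℝ),
      0 < N ∧ (∃ v : Fin d → ℤ, ∀ i, N * c i = v i) ∧
      (∀ u : Fin e → ℤ, ∃ v : Fin d → ℤ, ∀ i, A (fun j ↦ (u j : ℝ)) i = v i) ∧
      (∀ m, (fun i ↦ Int.fract ((k : ℝ) ^ m * x i)) = c + b m + A (a m)) ∧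
      (∀ j, ∃ y, Tendsto (fun m ↦ a (j + m)) p (𝓝 y)) ∧
      (∀ᶠ r in (p : Filter ℕ), ∀ᶠ m in (p : Filter ℕ),
        a (r + m) = (k : ℝ) ^ r • a m + (1 - (k : ℝ) ^ r) • γ r) ∧
      (∀ᶠ r in (p : Filter ℕ), ∀ᶠ m in (p : Filter ℕ), b (r + m) = (k : ℝ) ^ r • b m) ∧
      ∀ B : Set ℕ, (∀ᶠ r in (p : Filter ℕ), r ∈ B) →
        Submodule.span ℝ {w | ∃ r ∈ B, ∃ s ∈ B, w = γ r - γ s} = ⊤ := by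
  choose v hv using exists_eventually_fract_pow_add_mul p k x
  let z : ℕ → Fin d → ℝ := fun m i ↦ Int.fract ((k : ℝ) ^ m * x i)
  let c : ℕ → Fin d → ℝ := fun r i ↦ v r i / ((k : ℝ) ^ r - 1)
  have hpos : ∀ᶠ r in (p : Filter ℕ), 1 ≤ r := hp (eventually_ge_atTop 1)
  have hκ : ∀ r, 1 ≤ r → 1 < (k : ℝ) ^ r := fun r hr ↦
    one_lt_pow₀ (by exact_mod_cast hk) (by omega)
  have hz : ∀ᶠ r in (p : Filter ℕ), ∀ᶠ m in (p : Filter ℕ),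
      z (r + m) = (k : ℝ) ^ r • z m + (1 - (k : ℝ) ^ r) • c r := by
    filter_upwards [hpos] with r hr
    filter_upwards [hv r] with m hm
    ext i
    have := sub_ne_zero.2 (hκ r hr).ne'
    simp only [z, c, hm i, Pi.add_apply, Pi.smul_apply, smul_eq_mul]
    field_simp
    ring
  obtain ⟨e, A, Q, c₀, N, hN, hNc, hQA, hA, hAQ, hspan⟩ :=
    exists_integral_parametrization (p := p) (c := c) (by
      filter_upwards [hpos] with r hr
      have h1 : 1 < k ^ r := by exact_mod_cast hκ r hr
      refine ⟨k ^ r - 1, by omega, v r, fun i ↦ ?_⟩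
      have := sub_ne_zero.2 (hκ r hr).ne'
      simp only [c]
      push_cast [h1.le]
      field_simp)
  have hQz : ∀ᶠ r in (p : Filter ℕ), ∀ᶠ m in (p : Filter ℕ), Q (z (r + m) - c₀) =
      (k : ℝ) ^ r • Q (z m - c₀) + (1 - (k : ℝ) ^ r) • Q (c r - c₀) := by
    filter_upwards [hz] with r hr
    filter_upwards [hr] with m hm
    rw [← map_smul, ← map_smul, ← map_add, hm]
    congr 1
    module
  refine ⟨e, A, c₀, N, fun m ↦ Q (z m - c₀), fun r ↦ Q (c r - c₀),
    fun m ↦ z m - c₀ - A (Q (z m - c₀)), hN, hNc, hA, fun m ↦ ?_, fun j ↦ ?_, hQz, ?_, hspan⟩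
  · change z m = c₀ + (z m - c₀ - A (Q (z m - c₀))) + A (Q (z m - c₀))
    rw [add_assoc, sub_add_cancel, add_sub_cancel]
  · obtain ⟨y, hy⟩ := exists_tendsto_of_eventually_abs_le (p := p) (f := fun m ↦ z (j + m))
      (R := 1) (Eventually.of_forall fun m i ↦ by
        rw [abs_of_nonneg (Int.fract_nonneg _)]
        exact (Int.fract_lt_one _).le)
    exact ⟨Q (y - c₀), (Q.continuous_of_finiteDimensional.tendsto _).comp (hy.sub_const c₀)⟩
  · filter_upwards [hz, hQz, hAQ] with r h1 h2 h3
    filter_upwards [h1, h2] with m h4 h5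
    rw [h5, map_add, map_smul, map_smul, h3, h4]
    module

theorem eventually_add_eq_of_tendsto {p : Ultrafilter ℕ} (hp : IsAddIdem p) {e : ℕ}
    {κ : ℕ → ℝ} {a γ β : ℕ → Fin e → ℝ}
    (hβ : ∀ j, Tendsto (fun m ↦ a (j + m)) p (𝓝 (β j)))
    (ha : ∀ᶠ r in (p : Filter ℕ), ∀ᶠ m in (p : Filter ℕ),
      a (r + m) = κ r • a m + (1 - κ r) • γ r) :
    ∀ᶠ r in (p : Filter ℕ), ∀ᶠ j in (p : Filter ℕ),
      β (r + j) = κ r • β j + (1 - κ r) • γ r := by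
  filter_upwards [ha] with r hr
  filter_upwards [(hp _).1 hr] with j hj
  refine tendsto_nhds_unique (hβ (r + j))
    ((((hβ j).const_smul (κ r)).add_const ((1 - κ r) • γ r)).congr' ?_)
  filter_upwards [hj] with m hm
  rw [← hm, add_assoc]

theorem eventually_sign_eval_eq {p : Ultrafilter ℕ} (hp : IsAddIdem p) {d e : ℕ} {κ : ℕ → ℝ}
    (hκ : ∀ᶠ r in (p : Filter ℕ), 2 ≤ κ r) {A : (Fin e → ℝ) →ₗ[ℝ] (Fin d → ℝ)} {c : Fin d → ℝ}
    {a γ β : ℕ → Fin e → ℝ} {b : ℕ → Fin d → ℝ}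
    (hβ : ∀ j, Tendsto (fun m ↦ a (j + m)) p (𝓝 (β j)))
    (ha : ∀ᶠ r in (p : Filter ℕ), ∀ᶠ m in (p : Filter ℕ),
      a (r + m) = κ r • a m + (1 - κ r) • γ r)
    (hb : ∀ᶠ r in (p : Filter ℕ), ∀ᶠ m in (p : Filter ℕ), b (r + m) = κ r • b m)
    (hspan : ∀ B : Set ℕ, (∀ᶠ r in (p : Filter ℕ), r ∈ B) →
      Submodule.span ℝ {w | ∃ r ∈ B, ∃ s ∈ B, w = γ r - γ s} = ⊤)
    (g : MvPolynomial (Fin d) ℝ) :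
    ∀ᶠ j in (p : Filter ℕ), ∀ᶠ δ in 𝓝[>] (0 : ℝ), ∀ t : ℝ, 0 < t → ∀ᶠ m in (p : Filter ℕ),
      ∀ a', dist a' (β j) ≤ δ →
        SignType.sign (MvPolynomial.eval (c + t • b (j + m) + A a') g) =
          SignType.sign (MvPolynomial.eval (c + b (j + m) + A (a (j + m))) g) := by
  rcases exists_eventually_sign_eq hp hκ A c hb g with h0 | ⟨P, hP, hsign⟩
  · filter_upwards [(hp _).1 h0] with j hj
    refine Eventually.of_forall fun δ t _ ↦ ?_
    filter_upwards [hj] with m hm a' _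
    have h1 := hm 1 (a (j + m))
    rw [one_smul] at h1
    rw [hm, h1]
  have hne : ∀ᶠ j in (p : Filter ℕ), MvPolynomial.eval (β j) P ≠ 0 :=
    Ultrafilter.eventually_not.2 fun h ↦ hP (eq_zero_of_eventually_eval_eq_zero hp
      (hκ.mono fun r hr ↦ by linarith) (eventually_add_eq_of_tendsto hp hβ ha) hspan h)
  filter_upwards [hne, hκ, hb] with j hj hκj hbj
  obtain ⟨δ₀, hδ₀, s, hs⟩ := hsign _ hj
  filter_upwards [Ioo_mem_nhdsGT hδ₀] with δ hδ t ht
  have hκ0 : 0 < κ j := by linarith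
  filter_upwards [hbj, hs (t * κ j) (by positivity), hs (κ j) hκ0,
    (hβ j).eventually (Metric.ball_mem_nhds _ hδ₀)] with m h1 h2 h3 h4 a' ha'
  rw [h1, smul_smul, h2 a' (ha'.trans hδ.2.le), h3 _ (Metric.mem_ball.1 h4).le]

end Renormalization

theorem IsSemialgebraic.exists_finset_sign {ι : Type} {S : Set (ι → ℝ)} (hS : IsSemialgebraic S) :
    ∃ G : Finset (MvPolynomial ι ℝ), ∀ y ∈ S, ∀ w, (∀ g ∈ G,
      SignType.sign (MvPolynomial.eval w g) = SignType.sign (MvPolynomial.eval y g)) → w ∈ S := by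
  classical
  obtain ⟨r, F, G, rfl⟩ := hS
  refine ⟨Finset.univ.biUnion fun i ↦ F i ∪ G i, fun y hy w hw ↦ ?_⟩
  obtain ⟨i, hF, hG⟩ := Set.mem_iUnion.1 hy
  refine Set.mem_iUnion.2 ⟨i, fun f hf ↦ ?_, fun g hg ↦ ?_⟩
  · rw [← sign_eq_zero_iff, hw f (Finset.mem_biUnion.2
      ⟨i, Finset.mem_univ _, Finset.mem_union_left _ hf⟩), hF f hf, sign_zero]
  · rw [← sign_eq_one_iff, hw g (Finset.mem_biUnion.2
      ⟨i, Finset.mem_univ _, Finset.mem_union_right _ hg⟩), sign_pos (hG g hg)]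

/-- Let `k ≥ 2`, `x ∈ ℝ^d`, and `S ⊆ [0,1)^d` semialgebraic. If
`{n : {kⁿ x} ∈ S}` is central, then `{l : {l·kⁿ x} ∈ S for infinitely many n}`
is IP*₊. -/
theorem torus_main (d k : ℕ) (hk : 2 ≤ k) (x : Fin d → ℝ)
    (S : Set (Fin d → ℝ)) (hS : IsSemialgebraic S)
    (hSsub : S ⊆ {y | ∀ i, y i ∈ Set.Ico (0 : ℝ) 1})
    (hcent : IsCentral {n : ℕ | (fun i => Int.fract ((k : ℝ) ^ n * x i)) ∈ S}) :
    IsIPStarPlus {l : ℕ |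
      {n : ℕ | (fun i => Int.fract ((l : ℝ) * (k : ℝ) ^ n * x i)) ∈ S}.Infinite} := by
  obtain ⟨p, hp, hidem, hpS⟩ := exists_isAddIdem_of_isCentral hcent
  obtain ⟨e, A, c, N, a, γ, b, hN, ⟨v, hv⟩, hA, hz, hlim, ha, hb, hspan⟩ :=
    exists_renormalization hp hk x
  choose β hβ using hlim
  obtain ⟨G, hG⟩ := hS.exists_finset_sign
  have hκ : ∀ᶠ r in (p : Filter ℕ), 2 ≤ (k : ℝ) ^ r := by
    filter_upwards [hp (eventually_ge_atTop 1)] with r hr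
    have hk' : (2 : ℝ) ≤ k := by exact_mod_cast hk
    exact hk'.trans (le_self_pow₀ (by linarith) (by omega))
  obtain ⟨j, hj, hjS⟩ := (((eventually_all_finset G).2 fun g _ ↦
    eventually_sign_eval_eq hidem hκ (c := c) hβ ha hb hspan g).and ((hidem _).1 hpS)).exists
  obtain ⟨δ, hδ, hδ0⟩ := (((eventually_all_finset G).2 hj).and self_mem_nhdsWithin).exists
  refine ⟨1, ?_⟩
  rintro B ⟨a₀, -, hB⟩
  obtain ⟨n, hn, ⟨q, rfl⟩, u, hu⟩ := exists_mem_FS_dvd_approx a₀ (β j) hδ0 hN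
  refine ⟨N * q, ⟨N * q + 1, ?_, by push_cast; ring⟩, hB hn⟩
  obtain ⟨v', hv'⟩ := hA u
  set t : ℝ := ((N * q + 1 : ℕ) : ℝ) with ht
  have htpos : 0 < t := by positivity
  have hclose : ∀ᶠ m in (p : Filter ℕ),
      t • a (j + m) - (fun i ↦ (u i : ℝ)) ∈ Metric.ball (β j) δ := by
    refine (((hβ j).const_smul t).sub_const _).eventually (Metric.isOpen_ball.mem_nhds ?_)
    rw [Metric.mem_ball, dist_pi_lt_iff hδ0]
    intro i
    have := hu i
    rw [Real.dist_eq, Pi.sub_apply, Pi.smul_apply, smul_eq_mul, ht]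
    push_cast at this ⊢
    convert this using 2
    ring
  have hmem : ∀ᶠ m in (p : Filter ℕ), (fun i ↦ Int.fract (t * (k : ℝ) ^ (j + m) * x i)) ∈ S := by
    filter_upwards [hjS, hclose, (eventually_all_finset G).2 fun g hg ↦ hδ g hg t htpos]
      with m hmS hm hsign
    have hw := hG _ hmS _ fun g hg ↦
      (hsign g hg _ (Metric.mem_ball.1 hm).le).trans (by rw [← hz])
    convert hw using 1
    ext i
    refine Int.fract_eq_iff.2 ⟨(hSsub hw i).1, (hSsub hw i).2,
      (N * q + 1) * ⌊(k : ℝ) ^ (j + m) * x i⌋ + q * v i + v' i, ?_⟩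
    have h1 := congrFun (hz (j + m)) i
    have h2 := Int.fract_add_floor ((k : ℝ) ^ (j + m) * x i)
    have h3 := hv' i
    generalize ⌊(k : ℝ) ^ (j + m) * x i⌋ = f at h2 ⊢
    simp only [Pi.add_apply] at h1
    simp only [map_sub, map_smul, Pi.add_apply, Pi.sub_apply, Pi.smul_apply, smul_eq_mul]
    rw [h3, mul_assoc, ← h2, h1, ht]
    push_cast
    rw [← hv i]
    ring
  exact Nat.frequently_atTop_iff_infinite.1
    ((tendsto_atTop_mono (fun m ↦ Nat.le_add_left m j) tendsto_id).frequently
      (hmem.frequently.filter_mono hp))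
end
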